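/- arXiv:1810.05280 — 2 statements merged into one kernel-verified Lean document; each statement's English description precedes it below -/
import Mathlib

section
/- For every finite simple graph G, χ_DP(G) ≤ ω(G) + i(G), where ω(G) is the clique number and i(G) is the non-chordality index of G. Moreover, if G is non-chordal and has no K_n minor, then χ_DP(G) ≤ n − 2 + i(G). -/
open SimpleGraph

variable {V : Type*}

/-- A *hole* of `G`: an induced cycle of length at least 4, given as a closed walk. -/
def IsHole (G : SimpleGraph V) {a : V} (w : G.Walk a a) : Prop :=
  w.IsCycle ∧ 4 ≤ w.length ∧
    ∀ x y : V, x ∈ w.support → y ∈ w.support → G.Adj x y → s(x, y) ∈ w.edges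

/-- A graph is *chordal* if it has no hole. -/
def IsChordal (G : SimpleGraph V) : Prop :=
  ∀ (a : V) (w : G.Walk a a), ¬ IsHole G w

/-- Two edge lists share two consecutive edges. -/
def ShareTwoConsecutiveEdges (l₁ l₂ : List (Sym2 V)) : Prop :=
  ∃ x y z : V, x ≠ z ∧ s(x, y) ∈ l₁ ∧ s(y, z) ∈ l₁ ∧ s(x, y) ∈ l₂ ∧ s(y, z) ∈ l₂

/-- A vertex `u` satisfies the *NC property* in `G`: no hole through `u` and
no hole avoiding `u` share two consecutive edges. -/
def VertexNC (G : SimpleGraph V) (u : V) : Prop :=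
  ∀ (a b : V) (w₁ : G.Walk a a) (w₂ : G.Walk b b),
    IsHole G w₁ → IsHole G w₂ → u ∈ w₁.support → u ∉ w₂.support →
      ¬ ShareTwoConsecutiveEdges w₁.edges w₂.edges

/-- A *hole cover* of `G`: a nonempty vertex set meeting every hole of `G`. -/
def IsHoleCover (G : SimpleGraph V) (C : Set V) : Prop :=
  C.Nonempty ∧ ∀ (a : V) (w : G.Walk a a), IsHole G w → ∃ u ∈ C, u ∈ w.support

/-- A vertex set `C` satisfies the *NC property* in `G`: every vertex of `C`
satisfies the NC property and every hole of `G` contains at most one vertex of `C`. -/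
def SetNC (G : SimpleGraph V) (C : Set V) : Prop :=
  (∀ u ∈ C, VertexNC G u) ∧
    ∀ (a : V) (w : G.Walk a a), IsHole G w →
      ∀ u ∈ C, ∀ v ∈ C, u ∈ w.support → v ∈ w.support → u = v

/-- A graph satisfies the *NC property* if it has a hole cover satisfying the NC property. -/
def HasNCProperty (G : SimpleGraph V) : Prop :=
  ∃ C : Set V, IsHoleCover G C ∧ SetNC G C

/-- A DP-cover of `G` with lists of size `k`, realized on the vertex set `V × Fin k`:
the fibers `{v} × Fin k` are cliques, cross edges exist only over edges of `G`,
and the edges between two fibers form a matching. -/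
def IsDPCover (G : SimpleGraph V) (k : ℕ) (H : SimpleGraph (V × Fin k)) : Prop :=
  (∀ (v : V) (i j : Fin k), i ≠ j → H.Adj (v, i) (v, j)) ∧
  (∀ (u v : V) (i j : Fin k), u ≠ v → H.Adj (u, i) (v, j) → G.Adj u v) ∧
  (∀ (u v : V) (i j j' : Fin k), u ≠ v → H.Adj (u, i) (v, j) → H.Adj (u, i) (v, j') → j = j')

/-- `G` is DP-`k`-colorable: every DP-cover with lists of size `k` admits an
independent transversal. -/
def DPColorable (G : SimpleGraph V) (k : ℕ) : Prop :=
  ∀ H : SimpleGraph (V × Fin k), IsDPCover G k H →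
    ∃ f : V → Fin k, ∀ u v : V, ¬ H.Adj (u, f u) (v, f v)

/-- The DP-chromatic number: the least `k` such that `G` is DP-`k`-colorable. -/
noncomputable def dpChromaticNumber (G : SimpleGraph V) : ℕ :=
  sInf {k | DPColorable G k}

/-- `M` is a minor of `G`, via the branch-set characterization. -/
def HasMinor {W : Type*} (G : SimpleGraph V) (M : SimpleGraph W) : Prop :=
  ∃ B : W → Set V,
    (∀ i, (B i).Nonempty) ∧
    (∀ i, (G.induce (B i)).Connected) ∧
    (Pairwise fun i j => Disjoint (B i) (B j)) ∧
    ∀ i j, M.Adj i j → ∃ a ∈ B i, ∃ b ∈ B j, G.Adj a b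

/-- Locally chordalize by `u` all holes of `G` containing `u`: add all edges
joining `u` to the vertices of such holes (new edges go to the vertices
nonadjacent to `u`). -/
def localChordalize (G : SimpleGraph V) (u : V) : SimpleGraph V :=
  G ⊔ SimpleGraph.fromRel fun x y =>
    x = u ∧ ∃ (a : V) (w : G.Walk a a), IsHole G w ∧ u ∈ w.support ∧ y ∈ w.support

/-- Recursive local chordalizations along a list of vertices. -/
def chordalizeList (G : SimpleGraph V) : List V → SimpleGraph V
  | [] => G
  | u :: l => chordalizeList (localChordalize G u) l

/-- Delete a vertex set (keeping the ambient vertex type: the removed vertices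
become isolated). -/
def removeVerts (G : SimpleGraph V) (A : Set V) : SimpleGraph V where
  Adj x y := G.Adj x y ∧ x ∉ A ∧ y ∉ A
  symm := by constructor; intro x y h; exact ⟨h.1.symm, h.2.2, h.2.1⟩
  loopless := by constructor; intro x h; exact G.loopless.irrefl x h.1

/-- The chordalization chain corresponding to an ordered partition
`parts 0, …, parts (k-1)` (playing the role of `C₁, …, C_k`) of a hole cover:
`(lcChain G parts i).1 = Gᵢ` and `(lcChain G parts i).2 = Gᵢ*`. -/
def lcChain (G : SimpleGraph V) {k : ℕ} (parts : Fin k → List V) :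
    ℕ → SimpleGraph V × SimpleGraph V
  | 0 =>
      (removeVerts G {v | ∃ i, v ∈ parts i}, removeVerts G {v | ∃ i, v ∈ parts i})
  | i + 1 =>
      let Gi := (lcChain G parts i).2 ⊔
        removeVerts G {v | ∃ j : Fin k, i + 1 ≤ (j : ℕ) ∧ v ∈ parts j}
      (Gi, if h : i < k then chordalizeList Gi (parts ⟨i, h⟩) else Gi)

/-- `(parts 0, …, parts (k-1))` is a *local chordalization partition* of the hole
cover `C` of `G`. -/
def IsLCPartition (G : SimpleGraph V) (C : Set V) {k : ℕ} (parts : Fin k → List V) : Prop :=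
  (∀ i, (parts i).Nodup) ∧
  (∀ i, parts i ≠ []) ∧
  (Pairwise fun i j : Fin k => ∀ v, v ∈ parts i → v ∉ parts j) ∧
  {v | ∃ i, v ∈ parts i} = C ∧
  ∀ i : Fin k,
    IsHoleCover (lcChain G parts ((i : ℕ) + 1)).1 {v | v ∈ parts i} ∧
    SetNC (lcChain G parts ((i : ℕ) + 1)).1 {v | v ∈ parts i} ∧
    IsChordal (lcChain G parts ((i : ℕ) + 1)).2

/-- The *non-chordality index* of `G`. -/
noncomputable def ncIndex (G : SimpleGraph V) : ℕ := by
  classical exact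
    if IsChordal G then 0
    else sInf {k | ∃ (C : Set V) (parts : Fin k → List V),
      IsHoleCover G C ∧ IsLCPartition G C parts}

/-- `G` is `k`-list-colorable. -/
def ListColorable (G : SimpleGraph V) (k : ℕ) : Prop :=
  ∀ L : V → Finset ℕ, (∀ v, k ≤ (L v).card) →
    ∃ f : V → ℕ, (∀ v, f v ∈ L v) ∧ ∀ u v : V, G.Adj u v → f u ≠ f v

/-- The list chromatic number of `G`. -/
noncomputable def listChromaticNumber (G : SimpleGraph V) : ℕ :=
  sInf {k | ListColorable G k}



def HSeq (G : SimpleGraph V) (n : ℕ) (f : ℕ → V) : Prop :=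
  4 ≤ n ∧ (∀ i j, i < j → j < n → f i ≠ f j) ∧
    ∀ i j, i < j → j < n → (G.Adj (f i) (f j) ↔ j = i + 1 ∨ (i = 0 ∧ j + 1 = n))

/-- vertex sets of holes -/
def HS (G : SimpleGraph V) (S : Set V) : Prop :=
  ∃ n f, HSeq G n f ∧ ∀ v, v ∈ S ↔ ∃ i, i < n ∧ f i = v

theorem HS_rot {G : SimpleGraph V} {S : Set V} (h : HS G S) {u : V} (hu : u ∈ S) :
    ∃ n f, HSeq G n f ∧ f 0 = u ∧ ∀ v, v ∈ S ↔ ∃ i, i < n ∧ f i = v := by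
  obtain ⟨n, f, ⟨h4, hinj, hadj⟩, hS⟩ := h
  obtain ⟨k, hk, rfl⟩ := (hS u).1 hu
  refine ⟨n, fun i => if i + k < n then f (i + k) else f (i + k - n), ⟨h4, ?_, ?_⟩, ?_, ?_⟩
  · intro i j hij hj
    dsimp only
    split_ifs with h1 h2 h2
    · exact hinj _ _ (by omega) (by omega)
    · exact (hinj _ _ (by omega) (by omega)).symm
    · omega
    · exact hinj _ _ (by omega) (by omega)
  · intro i j hij hj
    dsimp only
    split_ifs with h1 h2 h2
    · rw [hadj _ _ (by omega) (by omega)]; omega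
    · rw [G.adj_comm, hadj _ _ (by omega) (by omega)]; omega
    · omega
    · rw [hadj _ _ (by omega) (by omega)]; omega
  · simp [hk]
  · intro v
    rw [hS]
    dsimp only
    constructor
    · rintro ⟨i, hi, rfl⟩
      by_cases hik : k ≤ i
      · refine ⟨i - k, by omega, ?_⟩
        rw [if_pos (by omega)]; congr 1; omega
      · refine ⟨i + n - k, by omega, ?_⟩
        rw [if_neg (by omega)]; congr 1; omega
    · rintro ⟨i, hi, rfl⟩
      split_ifs with h1
      · exact ⟨_, h1, rfl⟩
      · exact ⟨i + k - n, by omega, rfl⟩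

theorem HS_of_hole {G : SimpleGraph V} {a : V} {w : G.Walk a a} (h : IsHole G w) :
    HS G {v | v ∈ w.support} := by
  obtain ⟨hc, h4, hind⟩ := h
  have hne : ∀ i j, i < j → j < w.length → w.getVert i ≠ w.getVert j := by
    intro i j hij hj he
    have := hc.getVert_injOn' (by simp only [Set.mem_ofPred_eq]; omega)
      (by simp only [Set.mem_ofPred_eq]; omega) he
    omega
  refine ⟨w.length, w.getVert, ⟨h4, hne, ?_⟩, ?_⟩
  · intro i j hij hj
    constructor
    · intro hA
      have := hind _ _ (w.getVert_mem_support i) (w.getVert_mem_support j) hA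
      rw [Walk.mk_mem_edges_iff_exists] at this
      have key : ∀ p q, p < w.length → q < w.length → w.getVert p = w.getVert q → p = q := by
        intro p q hp hq he
        rcases lt_trichotomy p q with h | h | h
        · exact absurd he (hne _ _ h hq)
        · exact h
        · exact absurd he.symm (hne _ _ h hp)
      have key2 : ∀ p q, p < w.length → q < w.length → w.getVert p = w.getVert (q+1) →
          p = q + 1 ∨ (p = 0 ∧ q + 1 = w.length) := by
        intro p q hp hq he
        by_cases hq' : q + 1 < w.length
        · exact Or.inl (key _ _ hp hq' he)
        · right
          have : q + 1 = w.length := by omega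
          refine ⟨key _ _ hp (by omega) ?_, this⟩
          rw [he, this]; simp
      obtain ⟨m, hm, h⟩ := this
      rw [Sym2.eq_iff] at h
      rcases h with ⟨h1, h2⟩ | ⟨h1, h2⟩
      · have e1 := key _ _ hm (by omega) h1
        have e2 := key2 _ _ hj hm h2.symm
        omega
      · have e1 := key _ _ hm (by omega) h1
        have e2 := key2 _ _ (by omega) hm h2.symm
        omega
    · rintro (rfl | ⟨rfl, hj⟩)
      · exact w.adj_getVert_succ (by omega)
      · have := w.adj_getVert_succ (i := j) (by omega)
        rw [hj] at this
        simpa using this.symm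
  · intro v
    simp only [Set.mem_ofPred_eq]
    rw [Walk.mem_support_iff_exists_getVert]
    constructor
    · rintro ⟨i, rfl, hi⟩
      rcases hi.lt_or_eq with h | h
      · exact ⟨i, h, rfl⟩
      · exact ⟨0, by omega, by rw [h]; simp⟩
    · rintro ⟨i, hi, rfl⟩
      exact ⟨i, rfl, hi.le⟩

theorem walk_of_seq (G : SimpleGraph V) (f : ℕ → V) (m : ℕ)
    (h : ∀ i, i < m → G.Adj (f i) (f (i+1))) :
    ∃ p : G.Walk (f 0) (f m), p.support = (List.range (m+1)).map f ∧
      p.edges = (List.range m).map (fun i => s(f i, f (i+1))) := by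
  induction m with
  | zero => exact ⟨.nil, by simp, by simp⟩
  | succ m ih =>
    obtain ⟨p, h1, h2⟩ := ih (fun i hi => h i (by omega))
    refine ⟨p.concat (h m (by omega)), ?_, ?_⟩
    · rw [Walk.support_concat, h1, List.range_succ (n := m+1)]; simp
    · rw [Walk.edges_concat, h2, List.range_succ (n := m)]; simp

theorem hole_of_HS {G : SimpleGraph V} {S : Set V} (h : HS G S) :
    ∃ (a : V) (w : G.Walk a a), IsHole G w ∧ ∀ v, v ∈ w.support ↔ v ∈ S := by
  obtain ⟨n, f, ⟨h4, hinj, hadj⟩, hS⟩ := h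
  obtain ⟨m, rfl⟩ : ∃ m, n = m + 1 := ⟨n - 1, by omega⟩
  have key : ∀ p q, p < m+1 → q < m+1 → f p = f q → p = q := by
    intro p q hp hq he
    rcases lt_trichotomy p q with h | h | h
    · exact absurd he (hinj _ _ h hq)
    · exact h
    · exact absurd he.symm (hinj _ _ h hp)
  obtain ⟨p, hp1, hp2⟩ := walk_of_seq G f m
    (fun i hi => (hadj i (i+1) (by omega) (by omega)).2 (Or.inl rfl))
  have hA : G.Adj (f m) (f 0) := ((hadj 0 m (by omega) (by omega)).2 (Or.inr ⟨rfl, rfl⟩)).symm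
  have hlen : p.length = m := by
    have := p.length_support
    rw [hp1] at this; simpa using this.symm
  have hsup : ∀ v, v ∈ (Walk.cons hA p).support ↔ v ∈ S := by
    intro v
    rw [hS, Walk.support_cons, hp1]
    simp only [List.mem_cons, List.mem_map, List.mem_range]
    constructor
    · rintro (rfl | h)
      · exact ⟨m, by omega, rfl⟩
      · exact h
    · exact Or.inr
  refine ⟨f m, Walk.cons hA p, ⟨?_, ?_, ?_⟩, hsup⟩
  · rw [Walk.cons_isCycle_iff]
    constructor
    · rw [Walk.isPath_def, hp1]
      refine List.Nodup.map_on ?_ List.nodup_range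
      intro x hx y hy he
      simp only [List.mem_range] at hx hy
      exact key _ _ hx hy he
    · rw [hp2]
      simp only [List.mem_map, List.mem_range, Sym2.eq_iff, not_exists, not_and]
      rintro i hi (⟨h1, h2⟩ | ⟨h1, h2⟩)
      · have := key _ _ (by omega) (by omega) h1; omega
      · have := key _ _ (by omega) (by omega) h1
        have := key _ _ (by omega) (by omega) h2; omega
  · simp [hlen]; omega
  · intro x y hx hy hxy
    obtain ⟨i, hi, rfl⟩ := (hS x).1 ((hsup x).1 hx)
    obtain ⟨j, hj, rfl⟩ := (hS y).1 ((hsup y).1 hy)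
    rw [Walk.edges_cons, hp2]
    simp only [List.mem_cons, List.mem_map, List.mem_range, Sym2.eq_iff]
    rcases lt_trichotomy i j with h | h | h
    · rcases (hadj _ _ h hj).1 hxy with rfl | ⟨rfl, h'⟩
      · exact Or.inr ⟨i, by omega, Or.inl ⟨rfl, rfl⟩⟩
      · obtain rfl : j = m := by omega
        exact Or.inl (Or.inr ⟨rfl, rfl⟩)
    · subst h; exact absurd hxy (G.irrefl)
    · rcases (hadj _ _ h hi).1 hxy.symm with rfl | ⟨rfl, h'⟩
      · exact Or.inr ⟨j, by omega, Or.inr ⟨rfl, rfl⟩⟩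
      · obtain rfl : i = m := by omega
        exact Or.inl (Or.inl ⟨rfl, rfl⟩)

theorem chordal_iff {G : SimpleGraph V} : IsChordal G ↔ ∀ S, ¬ HS G S := by
  constructor
  · intro h S hS
    obtain ⟨a, w, hw, -⟩ := hole_of_HS hS
    exact h a w hw
  · intro h a w hw
    exact h _ (HS_of_hole hw)

def NCs (G : SimpleGraph V) (u : V) : Prop :=
  ∀ S T, HS G S → HS G T → u ∈ S → u ∉ T → ∀ x y z, x ≠ z → G.Adj x y → G.Adj y z →
    x ∈ S → y ∈ S → z ∈ S → x ∈ T → y ∈ T → z ∈ T → False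

theorem NCs_of {G : SimpleGraph V} {u : V} (h : VertexNC G u) : NCs G u := by
  intro S T hS hT hu hu' x y z hxz hxy hyz xS yS zS xT yT zT
  obtain ⟨a, w, hw, hwS⟩ := hole_of_HS hS
  obtain ⟨b, w', hw', hwT⟩ := hole_of_HS hT
  refine h a b w w' hw hw' ((hwS _).2 hu) (fun h => hu' ((hwT _).1 h)) ⟨x, y, z, hxz, ?_, ?_, ?_, ?_⟩
  · exact hw.2.2 _ _ ((hwS _).2 xS) ((hwS _).2 yS) hxy
  · exact hw.2.2 _ _ ((hwS _).2 yS) ((hwS _).2 zS) hyz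
  · exact hw'.2.2 _ _ ((hwT _).2 xT) ((hwT _).2 yT) hxy
  · exact hw'.2.2 _ _ ((hwT _).2 yT) ((hwT _).2 zT) hyz

def SNC (G : SimpleGraph V) (D : Set V) : Prop :=
  (∀ u ∈ D, NCs G u) ∧ ∀ S, HS G S → ∀ u ∈ D, ∀ v ∈ D, u ∈ S → v ∈ S → u = v

theorem SNC_of {G : SimpleGraph V} {D : Set V} (h : SetNC G D) : SNC G D := by
  refine ⟨fun u hu => NCs_of (h.1 u hu), ?_⟩
  intro S hS u hu v hv huS hvS
  obtain ⟨a, w, hw, hwS⟩ := hole_of_HS hS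
  exact h.2 a w hw u hu v hv ((hwS _).2 huS) ((hwS _).2 hvS)

/-- connection inside a vertex set -/
def Conn (G : SimpleGraph V) (W : Set V) (x y : V) : Prop :=
  Relation.ReflTransGen (fun s t => G.Adj s t ∧ s ∈ W ∧ t ∈ W) x y

theorem Conn.mono {G : SimpleGraph V} {W W' : Set V} {x y : V} (h : Conn G W x y) (hW : W ⊆ W') :
    Conn G W' x y := by
  induction h with
  | refl => exact .refl
  | tail _ h2 ih => exact Relation.ReflTransGen.tail ih ⟨h2.1, hW h2.2.1, hW h2.2.2⟩

theorem Conn.symm {G : SimpleGraph V} {W : Set V} {x y : V} (h : Conn G W x y) : Conn G W y x := by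
  induction h with
  | refl => exact .refl
  | tail _ h2 ih => exact Relation.ReflTransGen.head ⟨h2.1.symm, h2.2.2, h2.2.1⟩ ih

theorem Conn.trans {G : SimpleGraph V} {W : Set V} {x y z : V} (h : Conn G W x y)
    (h' : Conn G W y z) : Conn G W x z := Relation.ReflTransGen.trans h h'

theorem Conn.edge {G : SimpleGraph V} {W : Set V} {x y : V} (h : G.Adj x y) (hx : x ∈ W)
    (hy : y ∈ W) : Conn G W x y := Relation.ReflTransGen.single ⟨h, hx, hy⟩

theorem Conn.mem {G : SimpleGraph V} {W : Set V} {x y : V} (h : Conn G W x y) (hx : x ∈ W) :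
    y ∈ W := by
  induction h with
  | refl => exact hx
  | tail _ h2 _ => exact h2.2.2

/-- path sequences -/
def PSeq (G : SimpleGraph V) (W : Set V) (m : ℕ) (f : ℕ → V) : Prop :=
  (∀ i, i ≤ m → f i ∈ W) ∧ ∀ i, i < m → G.Adj (f i) (f (i+1))

theorem Conn.seq {G : SimpleGraph V} {W : Set V} {x y : V} (h : Conn G W x y) (hx : x ∈ W) :
    ∃ m f, PSeq G W m f ∧ f 0 = x ∧ f m = y := by
  induction h with
  | refl => exact ⟨0, fun _ => x, ⟨fun _ _ => hx, fun i hi => by omega⟩, rfl, rfl⟩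
  | @tail b c _ h2 ih =>
    obtain ⟨m, f, ⟨h3, h4⟩, h5, h6⟩ := ih
    refine ⟨m + 1, fun i => if i ≤ m then f i else c, ⟨?_, ?_⟩, ?_, ?_⟩
    · intro i hi
      dsimp only
      split_ifs with h
      · exact h3 i h
      · exact h2.2.2
    · intro i hi
      dsimp only
      rw [if_pos (by omega)]
      split_ifs with h
      · exact h4 i (by omega)
      · obtain rfl : i = m := by omega
        rw [h6]; exact h2.1
    · simpa using h5
    · simp

theorem PSeq.conn {G : SimpleGraph V} {W : Set V} {m : ℕ} {f : ℕ → V} (h : PSeq G W m f) :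
    ∀ i, i ≤ m → Conn G W (f 0) (f i) := by
  intro i
  induction i with
  | zero => intro _; exact .refl
  | succ i ih =>
    intro hi
    exact (ih (by omega)).trans (Conn.edge (h.2 i (by omega)) (h.1 _ (by omega)) (h.1 _ hi))

/-- shortest connection between two sets -/
theorem shortest {G : SimpleGraph V} {W X Y : Set V} {x y : V} (h : Conn G W x y) (hxW : x ∈ W)
    (hx : x ∈ X) (hy : y ∈ Y) :
    ∃ m f, PSeq G W m f ∧ f 0 ∈ X ∧ f m ∈ Y ∧ (∀ i, 0 < i → i ≤ m → f i ∉ X) ∧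
      (∀ i, i < m → f i ∉ Y) ∧ (∀ i j, i < j → j ≤ m → f i ≠ f j) ∧
      ∀ i j, i + 1 < j → j ≤ m → ¬ G.Adj (f i) (f j) := by
  classical
  have hex : ∃ m, ∃ f, PSeq G W m f ∧ f 0 ∈ X ∧ f m ∈ Y := by
    obtain ⟨m, f, h1, rfl, rfl⟩ := h.seq hxW
    exact ⟨m, f, h1, hx, hy⟩
  obtain ⟨f, hf, h0, hm⟩ := Nat.find_spec hex
  have hmin := fun k (hk : k < Nat.find hex) => Nat.find_min hex hk
  generalize Nat.find hex = m at *
  have hcut : ∀ i j, i < j → j ≤ m → f i ≠ f j := by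
    intro i j hij hj he
    apply hmin (m - (j - i)) (by omega)
    refine ⟨fun t => if t ≤ i then f t else f (t + (j - i)), ⟨?_, ?_⟩, ?_, ?_⟩
    · intro t ht
      dsimp only
      split_ifs <;> exact hf.1 _ (by omega)
    · intro t ht
      dsimp only
      split_ifs with h1 h2 h2
      · exact hf.2 _ (by omega)
      · obtain rfl : t = i := by omega
        rw [he]
        have := hf.2 j (by omega)
        rwa [show t + 1 + (j - t) = j + 1 by omega]
      · omega
      · have := hf.2 (t + (j-i)) (by omega)
        rwa [show t + 1 + (j - i) = t + (j-i) + 1 by omega]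
    · simpa using h0
    · dsimp only
      split_ifs with h1
      · obtain rfl : j = m := by omega
        rw [show j - (j-i) = i by omega, he]; exact hm
      · rwa [show m - (j-i) + (j-i) = m by omega]
  refine ⟨m, f, hf, h0, hm, ?_, ?_, hcut, ?_⟩
  · intro i hi him hiX
    apply hmin (m - i) (by omega)
    refine ⟨fun t => f (t + i), ⟨fun t ht => hf.1 _ (by omega), fun t ht => ?_⟩, by simpa using hiX, ?_⟩
    · have := hf.2 (t+i) (by omega)
      rwa [show t + i + 1 = t + 1 + i by omega] at this
    · dsimp only
      rwa [show m - i + i = m by omega]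
  · intro i him hiY
    exact hmin i him ⟨f, ⟨fun t ht => hf.1 _ (by omega), fun t ht => hf.2 _ (by omega)⟩, h0, hiY⟩
  · intro i j hij hj hA
    apply hmin (m - (j - i - 1)) (by omega)
    refine ⟨fun t => if t ≤ i then f t else f (t + (j - i - 1)), ⟨?_, ?_⟩, ?_, ?_⟩
    · intro t ht
      dsimp only
      split_ifs <;> exact hf.1 _ (by omega)
    · intro t ht
      dsimp only
      split_ifs with h1 h2 h2
      · exact hf.2 _ (by omega)
      · obtain rfl : t = i := by omega
        rwa [show t + 1 + (j - t - 1) = j by omega]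
      · omega
      · have := hf.2 (t + (j-i-1)) (by omega)
        rwa [show t + 1 + (j - i - 1) = t + (j-i-1) + 1 by omega]
    · simpa using h0
    · dsimp only
      rw [if_neg (by omega), show m - (j-i-1) + (j-i-1) = m by omega]; exact hm

theorem crossing {f : ℕ → V} {P : Set V} {m : ℕ} (h0 : f 0 ∈ P) (hm : f m ∉ P) :
    ∃ i, i < m ∧ f i ∈ P ∧ f (i+1) ∉ P := by
  by_contra hcon
  push Not at hcon
  have : ∀ i, i ≤ m → f i ∈ P := by
    intro i
    induction i with
    | zero => exact fun _ => h0
    | succ i ih => exact fun hi => hcon i (by omega) (ih (by omega))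
  exact hm (this m le_rfl)

/-- a vertex together with a chordless path whose ends are its only neighbours is a hole -/
theorem HS_cone {G : SimpleGraph V} {c : V} {m : ℕ} {f : ℕ → V} (hm : 2 ≤ m)
    (hadj : ∀ i, i < m → G.Adj (f i) (f (i+1)))
    (hinj : ∀ i j, i < j → j ≤ m → f i ≠ f j)
    (hch : ∀ i j, i + 1 < j → j ≤ m → ¬ G.Adj (f i) (f j))
    (hc : ∀ i, i ≤ m → f i ≠ c) (hc0 : G.Adj c (f 0)) (hcm : G.Adj c (f m))
    (hci : ∀ i, 0 < i → i < m → ¬ G.Adj c (f i)) :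
    HS G {v | v = c ∨ ∃ i, i ≤ m ∧ f i = v} := by
  refine ⟨m + 2, fun i => if i = 0 then c else f (i - 1), ⟨by omega, ?_, ?_⟩, ?_⟩
  · intro i j hij hj
    dsimp only
    rw [if_neg (show ¬ j = 0 by omega)]
    split_ifs with h
    · exact (hc _ (by omega)).symm
    · exact hinj _ _ (by omega) (by omega)
  · intro i j hij hj
    dsimp only
    rw [if_neg (show ¬ j = 0 by omega)]
    split_ifs with h
    · subst h
      constructor
      · intro hA
        by_contra hcon
        exact hci (j-1) (by omega) (by omega) hA
      · rintro (rfl | h)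
        · exact hc0
        · obtain rfl : j = m + 1 := by omega
          exact hcm
    · constructor
      · intro hA
        by_contra hcon
        exact hch _ _ (by omega) (by omega) hA
      · rintro (rfl | h)
        · have := hadj (i-1) (by omega)
          rwa [show i - 1 + 1 = i + 1 - 1 by omega] at this
        · omega
  · intro v
    simp only [Set.mem_ofPred_eq]
    constructor
    · rintro (rfl | ⟨i, hi, rfl⟩)
      · exact ⟨0, by omega, by simp⟩
      · exact ⟨i+1, by omega, by simp⟩
    · rintro ⟨i, hi, rfl⟩
      split_ifs with h
      · exact Or.inl rfl
      · exact Or.inr ⟨i-1, by omega, rfl⟩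


structure Arc (G : SimpleGraph V) (S : Set V) (u t : V) (R : Set V) (t1 y : V) : Prop where
  sub : R ⊆ S
  hu : u ∉ R
  ht : t ∉ R
  t1R : t1 ∈ R
  yR : y ∈ R
  tt1 : G.Adj t t1
  uy : G.Adj u y
  tuniq : ∀ r ∈ R, G.Adj t r → r = t1
  uuniq : ∀ r ∈ R, G.Adj u r → r = y
  conn : ∀ r ∈ R, Conn G R t1 r

theorem HSeq.inj {G : SimpleGraph V} {n : ℕ} {f : ℕ → V} (h : HSeq G n f) :
    ∀ p q, p < n → q < n → f p = f q → p = q := by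
  intro p q hp hq he
  rcases lt_trichotomy p q with h' | h' | h'
  · exact absurd he (h.2.1 _ _ h' hq)
  · exact h'
  · exact absurd he.symm (h.2.1 _ _ h' hp)

theorem HSeq.adj {G : SimpleGraph V} {n : ℕ} {f : ℕ → V} (h : HSeq G n f) :
    ∀ p q, p < n → q < n → (G.Adj (f p) (f q) ↔
      q = p + 1 ∨ p = q + 1 ∨ (p = 0 ∧ q + 1 = n) ∨ (q = 0 ∧ p + 1 = n)) := by
  intro p q hp hq
  have h4 := h.1
  rcases lt_trichotomy p q with h' | h' | h'
  · rw [h.2.2 _ _ h' hq]; omega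
  · subst h'
    simp only [SimpleGraph.irrefl, false_iff]; omega
  · rw [G.adj_comm, h.2.2 _ _ h' hp]; omega

theorem conn_interval {G : SimpleGraph V} {f : ℕ → V} {W : Set V} {lo hi : ℕ}
    (hW : ∀ i, lo ≤ i → i ≤ hi → f i ∈ W) (hA : ∀ i, lo ≤ i → i < hi → G.Adj (f i) (f (i+1))) :
    ∀ i, lo ≤ i → i ≤ hi → Conn G W (f lo) (f i) := by
  intro i hlo
  induction i, hlo using Nat.le_induction with
  | base => intro _; exact .refl
  | succ i hi ih =>
    intro h
    exact (ih (by omega)).trans (Conn.edge (hA i hi (by omega)) (hW _ hi (by omega)) (hW _ (by omega) h))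

theorem split {G : SimpleGraph V} {S : Set V} (h : HS G S) {u t : V} (hu : u ∈ S) (ht : t ∈ S)
    (hut : u ≠ t) (hna : ¬ G.Adj u t) :
    ∃ R1 R2 t1 t2 y1 y2, Arc G S u t R1 t1 y1 ∧ Arc G S u t R2 t2 y2 ∧
      (∀ r ∈ R1, ∀ s ∈ R2, r ≠ s ∧ ¬ G.Adj r s) ∧
      ∀ s ∈ S, s = u ∨ s = t ∨ s ∈ R1 ∨ s ∈ R2 := by
  obtain ⟨n, f, hf, rfl, hS⟩ := HS_rot h hu
  obtain ⟨k, hk, rfl⟩ := (hS t).1 ht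
  have h4 := hf.1
  have hadj := hf.adj
  have hinj := hf.inj
  have hk0 : k ≠ 0 := by rintro rfl; exact hut rfl
  have hk1 := (hadj 0 k (by omega) hk).not.1 hna
  refine ⟨{v | ∃ i, 0 < i ∧ i < k ∧ f i = v}, {v | ∃ i, k < i ∧ i < n ∧ f i = v},
    f (k-1), f (k+1), f 1, f (n-1), ?_, ?_, ?_, ?_⟩
  · constructor
    · rintro _ ⟨i, h1, h2, rfl⟩; exact (hS _).2 ⟨i, by omega, rfl⟩
    · rintro ⟨i, h1, h2, h3⟩; have := hinj _ _ (by omega) (by omega) h3; omega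
    · rintro ⟨i, h1, h2, h3⟩; have := hinj _ _ (by omega) (by omega) h3; omega
    · exact ⟨k-1, by omega, by omega, rfl⟩
    · exact ⟨1, by omega, by omega, rfl⟩
    · rw [hadj _ _ (by omega) (by omega)]; omega
    · rw [hadj _ _ (by omega) (by omega)]; omega
    · rintro _ ⟨i, h1, h2, rfl⟩ hA
      rw [hadj _ _ (by omega) (by omega)] at hA; congr 1; omega
    · rintro _ ⟨i, h1, h2, rfl⟩ hA
      rw [hadj _ _ (by omega) (by omega)] at hA; congr 1; omega
    · rintro _ ⟨i, h1, h2, rfl⟩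
      have key := conn_interval (G := G) (f := f) (W := {v | ∃ i, 0 < i ∧ i < k ∧ f i = v}) (lo := 1)
        (hi := k - 1) (fun i h1 h2 => ⟨i, by omega, by omega, rfl⟩)
        (fun i h1 h2 => by rw [hadj _ _ (by omega) (by omega)]; omega)
      exact (key (k-1) (by omega) (by omega)).symm.trans (key i (by omega) (by omega))
  · constructor
    · rintro _ ⟨i, h1, h2, rfl⟩; exact (hS _).2 ⟨i, by omega, rfl⟩
    · rintro ⟨i, h1, h2, h3⟩; have := hinj _ _ (by omega) (by omega) h3; omega
    · rintro ⟨i, h1, h2, h3⟩; have := hinj _ _ (by omega) (by omega) h3; omega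
    · exact ⟨k+1, by omega, by omega, rfl⟩
    · exact ⟨n-1, by omega, by omega, rfl⟩
    · rw [hadj _ _ (by omega) (by omega)]; omega
    · rw [hadj _ _ (by omega) (by omega)]; omega
    · rintro _ ⟨i, h1, h2, rfl⟩ hA
      rw [hadj _ _ (by omega) (by omega)] at hA; congr 1; omega
    · rintro _ ⟨i, h1, h2, rfl⟩ hA
      rw [hadj _ _ (by omega) (by omega)] at hA; congr 1; omega
    · rintro _ ⟨i, h1, h2, rfl⟩
      have key := conn_interval (G := G) (f := f) (W := {v | ∃ i, k < i ∧ i < n ∧ f i = v}) (lo := k+1)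
        (hi := n - 1) (fun i h1 h2 => ⟨i, by omega, by omega, rfl⟩)
        (fun i h1 h2 => by rw [hadj _ _ (by omega) (by omega)]; omega)
      exact key i (by omega) (by omega)
  · rintro _ ⟨i, h1, h2, rfl⟩ _ ⟨j, h3, h4, rfl⟩
    refine ⟨fun he => ?_, ?_⟩
    · have := hinj _ _ (by omega) (by omega) he; omega
    · rw [hadj _ _ (by omega) (by omega)]; omega
  · intro s hs
    obtain ⟨i, hi, rfl⟩ := (hS s).1 hs
    rcases Nat.eq_zero_or_pos i with rfl | h0
    · exact Or.inl rfl
    · rcases lt_trichotomy i k with h1 | rfl | h1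
      · exact Or.inr (Or.inr (Or.inl ⟨i, h0, h1, rfl⟩))
      · exact Or.inr (Or.inl rfl)
      · exact Or.inr (Or.inr (Or.inr ⟨i, h1, hi, rfl⟩))

/-- a connected set `R` from `t` to a unique neighbour `y` of `u` -/
structure Leg (G : SimpleGraph V) (u t : V) (R : Set V) (y : V) : Prop where
  hu : u ∉ R
  tR : t ∈ R
  yR : y ∈ R
  uy : G.Adj u y
  uuniq : ∀ r ∈ R, G.Adj u r → r = y
  conn : ∀ r ∈ R, Conn G R t r

theorem Arc.leg {G : SimpleGraph V} {S : Set V} {u t : V} {R : Set V} {t1 y : V}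
    (h : Arc G S u t R t1 y) (hut : u ≠ t) (hna : ¬ G.Adj u t) : Leg G u t (insert t R) y where
  hu := by
    rintro (h1 | h1)
    · exact hut h1
    · exact h.hu h1
  tR := Or.inl rfl
  yR := Or.inr h.yR
  uy := h.uy
  uuniq := by
    rintro r (rfl | hr) hA
    · exact absurd hA hna
    · exact h.uuniq r hr hA
  conn := by
    rintro r (rfl | hr)
    · exact .refl
    · exact (Conn.edge h.tt1 (Or.inl rfl) (Or.inr h.t1R)).trans
        ((h.conn r hr).mono (Set.subset_insert _ _))

theorem arc_avoid {G : SimpleGraph V} {S : Set V} (h : HS G S) {u t : V} (hu : u ∈ S) (ht : t ∈ S)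
    (hut : u ≠ t) (hna : ¬ G.Adj u t) (hNC : NCs G u) {c : V} (hcu : c ≠ u) (hct : c ≠ t)
    (hcna : ¬ G.Adj c t) :
    ∃ R y, Leg G u t R y ∧ ∀ r ∈ R, r ≠ c ∧ ¬ G.Adj c r := by
  obtain ⟨R1, R2, t1, t2, y1, y2, A1, A2, hanti, hcov⟩ := split h hu ht hut hna
  by_cases h1 : ∀ r ∈ R1, r ≠ c ∧ ¬ G.Adj c r
  · refine ⟨_, _, A1.leg hut hna, ?_⟩
    rintro r (rfl | hr)
    · exact ⟨hct.symm, hcna⟩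
    · exact h1 r hr
  by_cases h2 : ∀ r ∈ R2, r ≠ c ∧ ¬ G.Adj c r
  · refine ⟨_, _, A2.leg hut hna, ?_⟩
    rintro r (rfl | hr)
    · exact ⟨hct.symm, hcna⟩
    · exact h2 r hr
  exfalso
  have hc1 : c ∉ R1 := fun hc => h2 fun r hr => ⟨(hanti c hc r hr).1.symm, (hanti c hc r hr).2⟩
  have hc2 : c ∉ R2 := fun hc => h1 fun r hr =>
    ⟨(hanti r hr c hc).1, fun hA => (hanti r hr c hc).2 hA.symm⟩
  obtain ⟨r1, hr1, hA1⟩ : ∃ r ∈ R1, G.Adj c r := by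
    by_contra hcon
    push Not at hcon
    exact h1 fun r hr => ⟨fun he => hc1 (he ▸ hr), hcon r hr⟩
  obtain ⟨r2, hr2, hA2⟩ : ∃ r ∈ R2, G.Adj c r := by
    by_contra hcon
    push Not at hcon
    exact h2 fun r hr => ⟨fun he => hc2 (he ▸ hr), hcon r hr⟩
  have L1 := A1.leg hut hna
  have L2 := A2.leg hut hna
  have hconn : Conn G (insert t R1 ∪ insert t R2) r1 r2 :=
    ((L1.conn r1 (Or.inr hr1)).mono Set.subset_union_left).symm.trans
      ((L2.conn r2 (Or.inr hr2)).mono Set.subset_union_right)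
  obtain ⟨m, f, hP, h0, hm, hX, hY, hinj, hch⟩ := shortest (X := {r | r ∈ R1 ∧ G.Adj c r})
    (Y := {r | r ∈ R2 ∧ G.Adj c r}) hconn (Or.inl (Or.inr hr1)) ⟨hr1, hA1⟩ ⟨hr2, hA2⟩
  have hW : ∀ i, i ≤ m → f i = t ∨ f i ∈ R1 ∨ f i ∈ R2 := by
    intro i hi
    rcases hP.1 i hi with (h | h) | (h | h)
    · exact Or.inl h
    · exact Or.inr (Or.inl h)
    · exact Or.inl h
    · exact Or.inr (Or.inr h)
  obtain ⟨i, hi, hi1, hi2⟩ := crossing (P := R1) (m := m) h0.1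
    (fun hmR => (hanti _ hmR _ hm.1).1 rfl)
  have hit : f (i+1) = t := by
    rcases hW (i+1) (by omega) with h | h | h
    · exact h
    · exact absurd h hi2
    · exact absurd (hP.2 i hi) (hanti _ hi1 _ h).2
  have him : i + 1 < m := by
    rcases (show i + 1 ≤ m by omega).lt_or_eq with h | h
    · exact h
    · exact absurd (hit ▸ h ▸ hm.1) A2.ht
  have hT : HS G {v | v = c ∨ ∃ i, i ≤ m ∧ f i = v} := by
    refine HS_cone (by omega) hP.2 hinj hch ?_ h0.2 hm.2 ?_
    · intro j hj he
      rcases hW j hj with h | h | h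
      · exact hct (he ▸ h)
      · exact hc1 (he ▸ h)
      · exact hc2 (he ▸ h)
    · intro j hj1 hj2 hA
      rcases hW j hj2.le with h | h | h
      · exact hcna (h ▸ hA)
      · exact hX j hj1 hj2.le ⟨h, hA⟩
      · exact hY j hj2 ⟨h, hA⟩
  have hSW : ∀ j, j ≤ m → f j ∈ S := by
    intro j hj
    rcases hW j hj with h | h | h
    · exact h ▸ ht
    · exact A1.sub h
    · exact A2.sub h
  refine hNC S _ h hT hu ?_ (f i) (f (i+1)) (f (i+2)) (hinj _ _ (by omega) (by omega))
    (hP.2 _ hi) (hP.2 _ (by omega)) (hSW _ (by omega)) (hSW _ (by omega)) (hSW _ (by omega))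
    (Or.inr ⟨i, by omega, rfl⟩) (Or.inr ⟨i+1, by omega, rfl⟩) (Or.inr ⟨i+2, by omega, rfl⟩)
  rintro (h | ⟨j, hj, h⟩)
  · exact hcu h.symm
  · rcases hW j hj with h' | h' | h'
    · exact hut (h ▸ h')
    · exact A1.hu (h ▸ h')
    · exact A2.hu (h ▸ h')

theorem lc_adj_of_ne {G : SimpleGraph V} {u x y : V} (hx : x ≠ u) (hy : y ≠ u) :
    (localChordalize G u).Adj x y ↔ G.Adj x y := by
  simp [localChordalize, hx, hy]

theorem lc_adj {G : SimpleGraph V} {u y : V} (hy : y ≠ u) :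
    (localChordalize G u).Adj u y ↔ G.Adj u y ∨ ∃ S, HS G S ∧ u ∈ S ∧ y ∈ S := by
  have : (∃ S, HS G S ∧ u ∈ S ∧ y ∈ S) ↔
      ∃ (a : V) (w : G.Walk a a), IsHole G w ∧ u ∈ w.support ∧ y ∈ w.support := by
    constructor
    · rintro ⟨S, hS, h1, h2⟩
      obtain ⟨a, w, hw, hwS⟩ := hole_of_HS hS
      exact ⟨a, w, hw, (hwS _).2 h1, (hwS _).2 h2⟩
    · rintro ⟨a, w, hw, h1, h2⟩
      exact ⟨_, HS_of_hole hw, h1, h2⟩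
  rw [this]
  simp [localChordalize, hy, hy.symm]

theorem lc_le {G : SimpleGraph V} {u : V} : G ≤ localChordalize G u := le_sup_left

theorem leg_single {G : SimpleGraph V} {u t : V} (h : G.Adj u t) : Leg G u t {t} t where
  hu := h.ne
  tR := rfl
  yR := rfl
  uy := h
  uuniq := fun r hr _ => hr
  conn := by rintro r rfl; exact .refl

/-- no hole of the local chordalization by an NC vertex passes through that vertex -/
theorem lc_avoid {G : SimpleGraph V} {u : V} (hNC : NCs G u) {S : Set V}
    (hS : HS (localChordalize G u) S) : u ∉ S := by
  intro huS
  obtain ⟨n, f, hf, rfl, -⟩ := HS_rot hS huS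
  have h4 := hf.1
  have hadj := hf.adj
  have hinj := hf.inj
  have hne0 : ∀ i, 0 < i → i < n → f i ≠ f 0 := fun i h1 h2 he => by
    have := hinj _ _ h2 (by omega) he; omega
  obtain ⟨a, ha⟩ : ∃ a, a = f 1 := ⟨_, rfl⟩
  obtain ⟨b, hb⟩ : ∃ b, b = f (n-1) := ⟨_, rfl⟩
  generalize hu : f 0 = u at *
  have hau : a ≠ u := ha ▸ hne0 1 (by omega) (by omega)
  have hbu : b ≠ u := hb ▸ hne0 (n-1) (by omega) (by omega)
  have hab : a ≠ b := by
    rw [ha, hb]; intro he; have := hinj _ _ (by omega) (by omega) he; omega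
  have hnab : ¬ G.Adj a b := by
    rw [← lc_adj_of_ne hau hbu, ha, hb, hadj _ _ (by omega) (by omega)]; omega
  have hLa : (localChordalize G u).Adj u a := by
    rw [ha, ← hu, hu, ← hu]
    subst hu; rw [hadj _ _ (by omega) (by omega)]; omega
  have hLb : (localChordalize G u).Adj u b := by
    rw [hb]; subst hu; rw [hadj _ _ (by omega) (by omega)]; omega
  -- the interior of the hole
  have hint : ∀ i, 1 < i → i < n - 1 → ¬ (localChordalize G u).Adj u (f i) := by
    intro i h1 h2; subst hu; rw [hadj _ _ (by omega) (by omega)]; omega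
  -- the leg at b
  obtain ⟨Rb, y, Lb, hRb⟩ : ∃ R y, Leg G u b R y ∧ ∀ r ∈ R, r ≠ a ∧ ¬ G.Adj a r := by
    by_cases hub : G.Adj u b
    · refine ⟨_, _, leg_single hub, ?_⟩
      rintro r rfl; exact ⟨hab.symm, hnab⟩
    · rcases (lc_adj hbu).1 hLb with h | ⟨T, hT, huT, hbT⟩
      · exact absurd h hub
      · exact arc_avoid hT huT hbT hbu.symm hub hNC hau hab hnab
  let D : Set V := {t | t ≠ u ∧ t ≠ a ∧ ¬ G.Adj a t}
  let C : Set V := {t | Conn G D b t}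
  let Z : Set V := {t | t ∉ C ∧ t ≠ u ∧ ∃ c ∈ C, G.Adj t c}
  have hbD : b ∈ D := ⟨hbu, hab.symm, hnab⟩
  have hCD : ∀ t ∈ C, t ∈ D := fun t ht => Conn.mem ht hbD
  have hZa : ∀ t ∈ Z, G.Adj a t := by
    rintro t ⟨h1, h2, c, hc, htc⟩
    by_contra hna
    have hta : t ≠ a := by rintro rfl; exact (hCD c hc).2.2 htc
    exact h1 (Conn.trans hc (Conn.edge htc.symm (hCD c hc) ⟨h2, hta, hna⟩))
  have haC : a ∉ C := fun h => (hCD a h).2.1 rfl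
  have haZ : a ∉ Z := fun h => (hZa a h).ne rfl
  have hRbC : ∀ r ∈ Rb, r ∈ C := fun r hr =>
    (Lb.conn r hr).mono (fun s hs => ⟨fun h => Lb.hu (h ▸ hs), (hRb s hs).1, (hRb s hs).2⟩)
  -- the leg at a
  obtain ⟨Ra, x, La, hRa⟩ : ∃ R x, Leg G u a R x ∧ ∀ r ∈ R, r ∉ C ∧ r ∉ Z := by
    by_cases hua : G.Adj u a
    · refine ⟨_, _, leg_single hua, ?_⟩
      rintro r rfl; exact ⟨haC, haZ⟩
    rcases (lc_adj hau).1 hLa with h | ⟨T, hT, huT, haT⟩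
    · exact absurd h hua
    obtain ⟨R1, R2, t1, t2, y1, y2, A1, A2, hanti, hcov⟩ := split hT huT haT hau.symm hua
    have good : ∀ R t x, Arc G T u a R t x → t ∉ Z → ∀ r ∈ insert a R, r ∉ C ∧ r ∉ Z := by
      intro R t x A htZ
      have hRZ : ∀ r ∈ insert a R, r ∉ Z := by
        rintro r (rfl | hr) hrZ
        · exact haZ hrZ
        · exact htZ (A.tuniq r hr (hZa r hrZ) ▸ hrZ)
      intro r hr
      refine ⟨fun hrC => ?_, hRZ r hr⟩
      have L := A.leg hau.symm hua
      obtain ⟨m, g, hP, h0, hm⟩ := (L.conn r hr).seq (Or.inl rfl)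
      obtain ⟨i, hi, h1, h2⟩ := crossing (f := g) (P := Cᶜ) (m := m) (by rw [h0]; exact haC)
        (by rw [hm]; exact fun h => h hrC)
      refine hRZ (g i) (hP.1 i hi.le) ⟨h1, fun h => L.hu (h ▸ hP.1 i hi.le), g (i+1),
        not_not.1 h2, hP.2 i hi⟩
    by_cases h1 : t1 ∈ Z
    swap
    · exact ⟨_, _, A1.leg hau.symm hua, good _ _ _ A1 h1⟩
    by_cases h2 : t2 ∈ Z
    swap
    · exact ⟨_, _, A2.leg hau.symm hua, good _ _ _ A2 h2⟩
    exfalso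
    obtain ⟨h1C, h1u, c1, hc1, hA1⟩ := id h1
    obtain ⟨h2C, h2u, c2, hc2, hA2⟩ := id h2
    have hCC : ∀ c ∈ C, Conn G C b c := by
      intro c hc
      obtain ⟨m, g, hP, h0, hm⟩ := Conn.seq hc hbD
      have : PSeq G C m g := ⟨fun i hi => by have := hP.conn i hi; rw [h0] at this; exact this, hP.2⟩
      have := this.conn m le_rfl
      rwa [h0, hm] at this
    have hCsub : C ⊆ C ∪ {t1, t2} := Set.subset_union_left
    have hconn : Conn G (C ∪ {t1, t2}) t1 t2 :=
      (Conn.edge hA1 (Or.inr (Or.inl rfl)) (Or.inl hc1)).trans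
        (((hCC c1 hc1).symm.trans (hCC c2 hc2)).mono hCsub |>.trans
          (Conn.edge hA2.symm (Or.inl hc2) (Or.inr (Or.inr rfl))))
    obtain ⟨m, g, hP, h0, hm, hX, hY, ginj, gch⟩ := shortest (X := {t1}) (Y := {t2}) hconn
      (Or.inr (Or.inl rfl)) rfl rfl
    have h0' : g 0 = t1 := h0
    have hm' : g m = t2 := hm
    have h12 := hanti t1 A1.t1R t2 A2.t1R
    have hm2 : 2 ≤ m := by
      by_contra hlt
      have : m = 0 ∨ m = 1 := by omega
      rcases this with rfl | rfl
      · exact h12.1 (h0'.symm.trans hm')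
      · have := hP.2 0 (by omega)
        rw [h0', show 0 + 1 = 1 from rfl, hm'] at this
        exact h12.2 this
    have hH : HS G {v | v = a ∨ ∃ i, i ≤ m ∧ g i = v} := by
      refine HS_cone hm2 hP.2 ginj gch ?_ (h0' ▸ A1.tt1) (hm' ▸ A2.tt1) ?_
      · intro i hi he
        rcases hP.1 i hi with h | h | h
        · exact haC (he ▸ h)
        · exact A1.tt1.ne (he ▸ h)
        · exact A2.tt1.ne (he ▸ h)
      · intro i h1 h2 hA
        rcases hP.1 i h2.le with h | h | h
        · exact (hCD _ h).2.2 hA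
        · exact hX i h1 h2.le h
        · exact hY i h2 h
    refine hNC T _ hT hH huT ?_ t1 a t2 h12.1 A1.tt1.symm A2.tt1 (A1.sub A1.t1R) haT (A2.sub A2.t1R)
      (Or.inr ⟨0, by omega, h0'⟩) (Or.inl rfl) (Or.inr ⟨m, le_rfl, hm'⟩)
    rintro (h | ⟨i, hi, h⟩)
    · exact hau h.symm
    · rcases hP.1 i hi with h' | h' | h'
      · exact (hCD _ h').1 h
      · exact h1u (h ▸ h').symm
      · exact h2u (h ▸ h').symm
  -- conclusion
  let P : Set V := {v | ∃ i, 1 ≤ i ∧ i ≤ n - 1 ∧ f i = v}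
  have hPconn : Conn G P a b := by
    rw [ha, hb]
    refine conn_interval (G := G) (f := f) (W := P) (lo := 1) (hi := n-1)
      (fun i h1 h2 => ⟨i, h1, h2, rfl⟩) (fun i h1 h2 => ?_) (n-1) (by omega) le_rfl
    rw [← lc_adj_of_ne (hne0 i (by omega) (by omega)) (hne0 (i+1) (by omega) (by omega)),
      hadj _ _ (by omega) (by omega)]
    omega
  have hconn : Conn G (Ra ∪ P ∪ Rb) x y :=
    ((La.conn x La.yR).mono (fun s hs => Or.inl (Or.inl hs))).symm.trans
      ((hPconn.mono (fun s hs => Or.inl (Or.inr hs))).trans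
        ((Lb.conn y Lb.yR).mono (fun s hs => Or.inr hs)))
  obtain ⟨m, g, hP, h0, hm, hX, hY, ginj, gch⟩ := shortest (X := {x}) (Y := {y}) hconn
      (Or.inl (Or.inl La.yR)) rfl rfl
  have h0' : g 0 = x := h0
  have hm' : g m = y := hm
  have hyC := hRbC y Lb.yR
  have hxC := (hRa x La.yR).1
  have hxy : ¬ G.Adj x y := fun h =>
    (hRa x La.yR).2 ⟨hxC, fun h => La.hu (h ▸ La.yR), y, hyC, h⟩
  have hm2 : 2 ≤ m := by
    by_contra hlt
    have : m = 0 ∨ m = 1 := by omega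
    rcases this with rfl | rfl
    · exact hxC (h0'.symm.trans hm' ▸ hyC)
    · have := hP.2 0 (by omega)
      rw [h0', show 0 + 1 = 1 from rfl, hm'] at this
      exact hxy this
  have hgu : ∀ i, i ≤ m → g i ≠ u := by
    intro i hi he
    rcases hP.1 i hi with (h | ⟨j, h1, h2, h⟩) | h
    · exact La.hu (he ▸ h)
    · exact hne0 j (by omega) (by omega) (h.trans he)
    · exact Lb.hu (he ▸ h)
  have hPcase : ∀ i, i ≤ m → g i ∈ P → g i = a ∨ g i = b ∨ ¬ (localChordalize G u).Adj u (g i) := by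
    rintro i hi ⟨j, h1, h2, h⟩
    by_cases hj1 : j = 1
    · left; rw [← h, hj1, ha]
    by_cases hj2 : j = n - 1
    · right; left; rw [← h, hj2, hb]
    · right; right; rw [← h]; exact hint j (by omega) (by omega)
  have hH : HS G {v | v = u ∨ ∃ i, i ≤ m ∧ g i = v} := by
    refine HS_cone hm2 hP.2 ginj gch hgu (h0' ▸ La.uy) (hm' ▸ Lb.uy) ?_
    intro i h1 h2 hA
    have hRa' : g i ∉ Ra := fun h => hX i h1 h2.le (La.uuniq _ h hA)
    have hRb' : g i ∉ Rb := fun h => hY i h2 (Lb.uuniq _ h hA)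
    rcases hP.1 i h2.le with (h | h) | h
    · exact hRa' h
    · rcases hPcase i h2.le h with h | h | h
      · exact hRa' (h ▸ La.tR)
      · exact hRb' (h ▸ Lb.tR)
      · exact h (lc_le hA)
    · exact hRb' h
  obtain ⟨i, hi, h1, h2⟩ := crossing (f := g) (P := Cᶜ) (m := m) (by rw [h0']; exact hxC)
    (by rw [hm']; exact fun h => h hyC)
  have hiZ : g i ∈ Z := ⟨h1, hgu i hi.le, g (i+1), not_not.1 h2, hP.2 i hi⟩
  rcases hP.1 i hi.le with (h | h) | h
  · exact (hRa _ h).2 hiZ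
  · rcases hPcase i hi.le h with h | h | h
    · exact haZ (h ▸ hiZ)
    · exact h1 (h ▸ hRbC b Lb.tR)
    · exact h ((lc_adj (hgu i hi.le)).2 (Or.inr ⟨_, hH, Or.inl rfl, Or.inr ⟨i, hi.le, rfl⟩⟩))
  · exact h1 (hRbC _ h)

theorem HS_congr {G G' : SimpleGraph V} {S : Set V} (h : HS G S)
    (hGG : ∀ x ∈ S, ∀ y ∈ S, (G'.Adj x y ↔ G.Adj x y)) : HS G' S := by
  obtain ⟨n, f, ⟨h4, hinj, hadj⟩, hS⟩ := h
  refine ⟨n, f, ⟨h4, hinj, fun i j hij hj => ?_⟩, hS⟩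
  rw [hGG _ ((hS _).2 ⟨i, by omega, rfl⟩) _ ((hS _).2 ⟨j, hj, rfl⟩), hadj i j hij hj]

theorem HS_lc {G : SimpleGraph V} {u : V} (hNC : NCs G u) {S : Set V}
    (hS : HS (localChordalize G u) S) : HS G S ∧ u ∉ S := by
  have hu := lc_avoid hNC hS
  exact ⟨HS_congr hS fun x hx y hy =>
    (lc_adj_of_ne (fun h : x = u => hu (h ▸ hx)) (fun h : y = u => hu (h ▸ hy))).symm, hu⟩

theorem chordalizeList_edges (l : List V) : ∀ (G : SimpleGraph V), SNC G {v | v ∈ l} →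
    ∀ x y, (chordalizeList G l).Adj x y → G.Adj x y ∨
      ∃ S, HS G S ∧ x ∈ S ∧ y ∈ S ∧ (x ∈ l ∨ y ∈ l) := by
  induction l with
  | nil => intro G _ x y h; exact Or.inl h
  | cons u l ih =>
    intro G hG x y h
    have hu := hG.1 u (by simp)
    have hSNC : SNC (localChordalize G u) {v | v ∈ l} := by
      constructor
      · intro v hv S T hS hT hvS hvT a b c hac hab hbc aS bS cS aT bT cT
        obtain ⟨hS', huS⟩ := HS_lc hu hS
        obtain ⟨hT', huT⟩ := HS_lc hu hT
        have hne : ∀ t ∈ S, t ≠ u := fun t ht h => huS (h ▸ ht)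
        rw [lc_adj_of_ne (hne _ aS) (hne _ bS)] at hab
        rw [lc_adj_of_ne (hne _ bS) (hne _ cS)] at hbc
        exact hG.1 v (by simp only [Set.mem_ofPred_eq] at hv ⊢; simp [hv]) S T hS' hT' hvS hvT
          a b c hac hab hbc aS bS cS aT bT cT
      · intro S hS v hv v' hv' h1 h2
        simp only [Set.mem_ofPred_eq] at hv hv'
        exact hG.2 S (HS_lc hu hS).1 v (by simp [hv]) v' (by simp [hv']) h1 h2
    rcases ih _ hSNC x y h with h | ⟨S, hS, hx, hy, hxy⟩
    · by_cases hx : x = u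
      · subst hx
        rcases (lc_adj h.ne.symm).1 h with h | ⟨S, hS, h1, h2⟩
        · exact Or.inl h
        · exact Or.inr ⟨S, hS, h1, h2, by simp⟩
      · by_cases hy : y = u
        · subst hy
          rcases (lc_adj h.ne).1 h.symm with h | ⟨S, hS, h1, h2⟩
          · exact Or.inl h.symm
          · exact Or.inr ⟨S, hS, h2, h1, by simp⟩
        · exact Or.inl ((lc_adj_of_ne hx hy).1 h)
    · refine Or.inr ⟨S, (HS_lc hu hS).1, hx, hy, ?_⟩
      rcases hxy with h | h <;> simp [h]

/-- Two adjacent cover vertices cannot both see a common vertex through holes. -/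
theorem lemX {G : SimpleGraph V} {v z t : V} (hv : NCs G v) (hz : NCs G z)
    (hno : ∀ S, HS G S → v ∈ S → z ∈ S → False) (hvz : G.Adj v z) (htv : t ≠ v) (htz : t ≠ z)
    (hnv : ¬ G.Adj v t) (hnz : ¬ G.Adj z t) {H J : Set V} (hH : HS G H) (hJ : HS G J)
    (hvH : v ∈ H) (htH : t ∈ H) (hzJ : z ∈ J) (htJ : t ∈ J) : False := by
  obtain ⟨R, h, LR, hR⟩ := arc_avoid hH hvH htH htv.symm hnv hv hvz.ne.symm htz.symm hnz
  obtain ⟨Q, j, LQ, hQ⟩ := arc_avoid hJ hzJ htJ htz.symm hnz hz hvz.ne htv.symm hnv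
  have hconn : Conn G (insert z (R ∪ Q)) z h :=
    (Conn.edge LQ.uy (Or.inl rfl) (Or.inr (Or.inr LQ.yR))).trans
      (((LQ.conn j LQ.yR).mono (fun s hs => Or.inr (Or.inr hs))).symm.trans
        ((LR.conn h LR.yR).mono (fun s hs => Or.inr (Or.inl hs))))
  obtain ⟨m, g, hP, h0, hm, hX, hY, ginj, gch⟩ := shortest (X := {z}) (Y := {h}) hconn
      (Or.inl rfl) rfl rfl
  have h0' : g 0 = z := h0
  have hm' : g m = h := hm
  have hm2 : 2 ≤ m := by
    by_contra hlt
    have : m = 0 ∨ m = 1 := by omega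
    rcases this with rfl | rfl
    · exact (hR h LR.yR).1 (hm'.symm.trans h0')
    · have := hP.2 0 (by omega)
      rw [h0', show 0 + 1 = 1 from rfl, hm'] at this
      exact (hR h LR.yR).2 this
  refine hno {w | w = v ∨ ∃ i, i ≤ m ∧ g i = w} ?_ (Or.inl rfl) (Or.inr ⟨0, by omega, h0'⟩)
  refine HS_cone hm2 hP.2 ginj gch ?_ (h0' ▸ hvz) (hm' ▸ LR.uy) ?_
  · intro i hi he
    rcases hP.1 i hi with h | h | h
    · exact hvz.ne (he ▸ h)
    · exact LR.hu (he ▸ h)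
    · exact (hQ _ h).1 he
  · intro i h1 h2 hA
    rcases hP.1 i h2.le with h | h | h
    · exact hX i h1 h2.le h
    · exact hY i h2 (LR.uuniq _ h hA)
    · exact (hQ _ h).2 hA

theorem HS_four {G : SimpleGraph V} {a b c d : V} (hab : G.Adj a b) (hbc : G.Adj b c)
    (hcd : G.Adj c d) (hda : G.Adj d a) (hac : a ≠ c) (hbd : b ≠ d) (hnac : ¬ G.Adj a c)
    (hnbd : ¬ G.Adj b d) : ∃ S, HS G S ∧ a ∈ S ∧ b ∈ S := by
  let f : ℕ → V := fun i => if i = 0 then b else if i = 1 then c else d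
  have h0 : f 0 = b := rfl
  have h1 : f 1 = c := rfl
  have h2 : f 2 = d := rfl
  refine ⟨_, HS_cone (c := a) (m := 2) (f := f) le_rfl ?_ ?_ ?_ ?_ hab hda.symm ?_,
    Or.inl rfl, Or.inr ⟨0, by omega, h0⟩⟩
  · intro i hi
    obtain rfl | rfl : i = 0 ∨ i = 1 := by omega
    · exact hbc
    · exact hcd
  · intro i j hij hj
    obtain ⟨rfl, rfl⟩ | ⟨rfl, rfl⟩ | ⟨rfl, rfl⟩ :
      (i = 0 ∧ j = 1) ∨ (i = 0 ∧ j = 2) ∨ (i = 1 ∧ j = 2) := by omega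
    · exact hbc.ne
    · exact hbd
    · exact hcd.ne
  · intro i j hij hj
    obtain ⟨rfl, rfl⟩ : i = 0 ∧ j = 2 := by omega
    exact hnbd
  · intro i hi
    obtain rfl | rfl | rfl : i = 0 ∨ i = 1 ∨ i = 2 := by omega
    · exact hab.ne.symm
    · exact hac.symm
    · exact hda.ne
  · intro i hi hi2
    obtain rfl : i = 1 := by omega
    exact hnac

/-- `K` is a clique up to one vertex `v`, whose missing edges are spanned by holes -/
def NearAt (G : SimpleGraph V) (K : Set V) (v : V) : Prop :=
  (∀ x ∈ K, ∀ y ∈ K, x ≠ y → x ≠ v → y ≠ v → G.Adj x y) ∧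
    ∀ w ∈ K, w ≠ v → G.Adj v w ∨ ∃ S, HS G S ∧ v ∈ S ∧ w ∈ S

def Near (G : SimpleGraph V) (K : Set V) : Prop :=
  (∀ x ∈ K, ∀ y ∈ K, x ≠ y → G.Adj x y) ∨ ∃ v ∈ K, NearAt G K v

theorem near_of_clique {G : SimpleGraph V} {l : List V} (hG : SNC G {v | v ∈ l}) {K : Set V}
    (hK : ∀ x ∈ K, ∀ y ∈ K, x ≠ y → (chordalizeList G l).Adj x y) : Near G K := by
  have hE : ∀ x ∈ K, ∀ y ∈ K, x ≠ y → G.Adj x y ∨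
      ∃ S, HS G S ∧ x ∈ S ∧ y ∈ S ∧ (x ∈ l ∨ y ∈ l) :=
    fun x hx y hy hxy => chordalizeList_edges l G hG x y (hK x hx y hy hxy)
  have hE' : ∀ x ∈ K, ∀ y ∈ K, x ≠ y → ¬ G.Adj x y → ∃ S, HS G S ∧ x ∈ S ∧ y ∈ S := by
    intro x hx y hy hxy hn
    rcases hE x hx y hy hxy with h | ⟨S, h1, h2, h3, -⟩
    · exact absurd h hn
    · exact ⟨S, h1, h2, h3⟩
  by_cases hcl : ∀ x ∈ K, ∀ y ∈ K, x ≠ y → G.Adj x y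
  · exact Or.inl hcl
  right
  have hbad : ∀ P : V → Prop, (¬ ∀ x ∈ K, ∀ y ∈ K, x ≠ y → P x → P y → G.Adj x y) →
      ∃ v ∈ K, ∃ w ∈ K, v ∈ l ∧ P v ∧ P w ∧ v ≠ w ∧ ¬ G.Adj v w ∧ ∃ S, HS G S ∧ v ∈ S ∧ w ∈ S := by
    intro P hP
    push Not at hP
    obtain ⟨x, hx, y, hy, hxy, px, py, hn⟩ := hP
    rcases hE x hx y hy hxy with h | ⟨S, h1, h2, h3, h4 | h4⟩
    · exact absurd h hn
    · exact ⟨x, hx, y, hy, h4, px, py, hxy, hn, S, h1, h2, h3⟩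
    · exact ⟨y, hy, x, hx, h4, py, px, hxy.symm, fun h => hn h.symm, S, h1, h3, h2⟩
  obtain ⟨v, hv, w, hw, hvl, -, -, hvw, hnvw, H, hH, hvH, hwH⟩ := hbad (fun _ => True)
    (fun h => hcl fun x hx y hy hxy => h x hx y hy hxy trivial trivial)
  refine ⟨v, hv, ?_, fun w hw hwv => ?_⟩
  · by_contra hcon
    obtain ⟨z, hz, t, ht, hzl, hzv, htv, hzt, hnzt, J, hJ, hzJ, htJ⟩ := hbad (fun x => x ≠ v) hcon
    have hno : ∀ S, HS G S → v ∈ S → z ∈ S → False :=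
      fun S hS h1 h2 => hzv (hG.2 S hS v hvl z hzl h1 h2).symm
    have hno' : ∀ S, HS G S → z ∈ S → v ∈ S → False := fun S hS h1 h2 => hno S hS h2 h1
    have hAvz : G.Adj v z := by
      by_contra hn
      obtain ⟨S, hS, h1, h2⟩ := hE' v hv z hz hzv.symm hn
      exact hno S hS h1 h2
    have hwz : w ≠ z := fun h => hno H hH hvH (h ▸ hwH)
    by_cases h1 : G.Adj v t
    swap
    · obtain ⟨S, hS, hvS, htS⟩ := hE' v hv t ht htv.symm h1
      exact lemX (hG.1 v hvl) (hG.1 z hzl) hno hAvz htv hzt.symm h1 hnzt hS hJ hvS htS hzJ htJ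
    by_cases h2 : G.Adj z w
    swap
    · obtain ⟨S, hS, hzS, hwS⟩ := hE' z hz w hw hwz.symm h2
      exact lemX (hG.1 v hvl) (hG.1 z hzl) hno hAvz hvw.symm hwz hnvw h2 hH hS hvH hwH hzS hwS
    have hwt : w ≠ t := fun h => hnvw (h ▸ h1)
    have hAwt : G.Adj w t := by
      rcases hE w hw t ht hwt with h | ⟨S, hS, h1, h2, h3 | h3⟩
      · exact h
      · exact absurd (hG.2 H hH v hvl w h3 hvH hwH) hvw
      · exact absurd (hG.2 J hJ z hzl t h3 hzJ htJ) hzt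
    obtain ⟨S, hS, h3, h4⟩ := HS_four hAvz h2 hAwt h1.symm hvw hzt hnvw hnzt
    exact hno S hS h3 h4
  · by_cases h : G.Adj v w
    · exact Or.inl h
    · exact Or.inr (hE' v hv w hw hwv.symm h)


theorem HS_through {G : SimpleGraph V} {C : Set V} {a b z1 z2 : V}
    (hC : ∀ c ∈ C, c ≠ a ∧ ¬ G.Adj a c) (hconn : ∀ c ∈ C, Conn G C b c)
    (h1 : G.Adj a z1) (h2 : G.Adj a z2) (h12 : z1 ≠ z2) (hn : ¬ G.Adj z1 z2)
    (hc1 : ∃ c ∈ C, G.Adj z1 c) (hc2 : ∃ c ∈ C, G.Adj z2 c) : ∃ S, HS G S := by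
  obtain ⟨c1, hc1, hA1⟩ := hc1
  obtain ⟨c2, hc2, hA2⟩ := hc2
  have hconn : Conn G (C ∪ {z1, z2}) z1 z2 :=
    (Conn.edge hA1 (Or.inr (Or.inl rfl)) (Or.inl hc1)).trans
      (((hconn c1 hc1).symm.trans (hconn c2 hc2)).mono Set.subset_union_left |>.trans
        (Conn.edge hA2.symm (Or.inl hc2) (Or.inr (Or.inr rfl))))
  obtain ⟨m, g, hP, h0, hm, hX, hY, ginj, gch⟩ := shortest (X := {z1}) (Y := {z2}) hconn
    (Or.inr (Or.inl rfl)) rfl rfl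
  have h0' : g 0 = z1 := h0
  have hm' : g m = z2 := hm
  have hm2 : 2 ≤ m := by
    by_contra hlt
    have : m = 0 ∨ m = 1 := by omega
    rcases this with rfl | rfl
    · exact h12 (h0'.symm.trans hm')
    · have := hP.2 0 (by omega)
      rw [h0', show 0 + 1 = 1 from rfl, hm'] at this
      exact hn this
  refine ⟨_, HS_cone (c := a) hm2 hP.2 ginj gch ?_ (h0' ▸ h1) (hm' ▸ h2) ?_⟩
  · intro i hi he
    rcases hP.1 i hi with h | h | h
    · exact (hC _ h).1 he
    · exact h1.ne (he ▸ h)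
    · exact h2.ne (he ▸ h)
  · intro i h1 h2 hA
    rcases hP.1 i h2.le with h | h | h
    · exact (hC _ h).2 hA
    · exact hX i h1 h2.le h
    · exact hY i h2 h

theorem conn_comp {G : SimpleGraph V} {D : Set V} {b : V} (hb : b ∈ D) :
    ∀ c ∈ {t | Conn G D b t}, Conn G {t | Conn G D b t} b c := by
  intro c hc
  obtain ⟨m, g, hP, h0, hm⟩ := Conn.seq hc hb
  have : PSeq G {t | Conn G D b t} m g :=
    ⟨fun i hi => by have := hP.conn i hi; rw [h0] at this; exact this, hP.2⟩
  have := this.conn m le_rfl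
  rwa [h0, hm] at this

def Simp (G : SimpleGraph V) (S : Finset V) (s : V) : Prop :=
  ∀ x ∈ S, ∀ y ∈ S, G.Adj s x → G.Adj s y → x ≠ y → G.Adj x y

theorem simp_exists {G : SimpleGraph V} {S : Finset V} (hne : S.Nonempty)
    (h : ∀ a ∈ S, (∀ b ∈ S, b ≠ a → G.Adj a b) ∨ ∃ s ∈ S, s ≠ a ∧ ¬ G.Adj a s ∧ Simp G S s) :
    ∃ s ∈ S, Simp G S s := by
  by_cases hall : ∀ a ∈ S, ∀ b ∈ S, b ≠ a → G.Adj a b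
  · obtain ⟨a, ha⟩ := hne
    exact ⟨a, ha, fun x hx y hy _ _ hxy => hall x hx y hy hxy.symm⟩
  · push Not at hall
    obtain ⟨a, ha, b, hb, hba, hn⟩ := hall
    rcases h a ha with h | ⟨s, hs, -, -, h⟩
    · exact absurd (h b hb hba) hn
    · exact ⟨s, hs, h⟩

theorem dirac {G : SimpleGraph V} (hG : ∀ S, ¬ HS G S) : ∀ (N : ℕ) (S : Finset V), S.card ≤ N →
    ∀ a ∈ S, (∀ b ∈ S, b ≠ a → G.Adj a b) ∨ ∃ s ∈ S, s ≠ a ∧ ¬ G.Adj a s ∧ Simp G S s := by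
  classical
  intro N
  induction N with
  | zero =>
    intro S hS a ha
    rw [Finset.card_eq_zero.1 (Nat.le_zero.1 hS)] at ha
    simp at ha
  | succ N ih =>
    intro S hS a ha
    by_cases hall : ∀ b ∈ S, b ≠ a → G.Adj a b
    · exact Or.inl hall
    right
    push Not at hall
    obtain ⟨b, hb, hba, hn⟩ := hall
    let D : Set V := {t | t ∈ S ∧ t ≠ a ∧ ¬ G.Adj a t}
    let C : Set V := {t | Conn G D b t}
    let Z : Set V := {t | t ∈ S ∧ t ∉ C ∧ ∃ c ∈ C, G.Adj t c}
    have hbD : b ∈ D := ⟨hb, hba, hn⟩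
    have hCD : ∀ t ∈ C, t ∈ D := fun t ht => Conn.mem ht hbD
    have hZa : ∀ t ∈ Z, G.Adj a t := by
      rintro t ⟨h2, h1, c, hc, htc⟩
      by_contra hna
      have hta : t ≠ a := by rintro rfl; exact (hCD c hc).2.2 htc
      exact h1 (Conn.trans hc (Conn.edge htc.symm (hCD c hc) ⟨h2, hta, hna⟩))
    have hZZ : ∀ z1 ∈ Z, ∀ z2 ∈ Z, z1 ≠ z2 → G.Adj z1 z2 := by
      intro z1 h1 z2 h2 hne
      by_contra hcon
      obtain ⟨T, hT⟩ := HS_through (C := C) (fun c hc => (hCD c hc).2) (conn_comp hbD) (hZa _ h1)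
        (hZa _ h2) hne hcon h1.2.2 h2.2.2
      exact hG T hT
    have hbC : b ∈ C := Relation.ReflTransGen.refl
    have hnbr : ∀ s ∈ C, ∀ x ∈ S, G.Adj s x → x ∈ C ∨ x ∈ Z := by
      intro s hs x hx hA
      by_cases hxC : x ∈ C
      · exact Or.inl hxC
      · exact Or.inr ⟨hx, hxC, s, hs, hA.symm⟩
    suffices h : ∃ s ∈ C, ∀ x, x ∈ C ∨ x ∈ Z → ∀ y, y ∈ C ∨ y ∈ Z → G.Adj s x → G.Adj s y → x ≠ y →
        G.Adj x y by
      obtain ⟨s, hs, h⟩ := h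
      exact ⟨s, (hCD s hs).1, (hCD s hs).2.1, (hCD s hs).2.2, fun x hx y hy h1 h2 hxy =>
        h x (hnbr s hs x hx h1) y (hnbr s hs y hy h2) h1 h2 hxy⟩
    have hsmall : ∀ (T : Finset V), T ⊆ S → a ∉ T → T.card ≤ N := by
      intro T hT haT
      have : T ⊂ S := Finset.ssubset_iff_subset_ne.2 ⟨hT, fun h => haT (h ▸ ha)⟩
      have := Finset.card_lt_card this
      omega
    by_cases hz : ∃ z ∈ Z, ∃ t, (t ∈ C ∨ t ∈ Z) ∧ t ≠ z ∧ ¬ G.Adj z t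
    · obtain ⟨z, hz, t, ht, htz, hzt⟩ := hz
      have hmem : ∀ x, x ∈ S.filter (fun x => x ∈ C ∨ x ∈ Z) ↔ x ∈ C ∨ x ∈ Z := by
        intro x
        rw [Finset.mem_filter]
        refine ⟨fun h => h.2, fun h => ⟨?_, h⟩⟩
        rcases h with h | h
        · exact (hCD x h).1
        · exact h.1
      have haT : a ∉ S.filter (fun x => x ∈ C ∨ x ∈ Z) := by
        rw [hmem]
        rintro (h | h)
        · exact (hCD a h).2.1 rfl
        · exact (hZa a h).ne rfl
      rcases ih _ (hsmall _ (Finset.filter_subset _ _) haT) z ((hmem z).2 (Or.inr hz)) with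
        h | ⟨s, hs, hsz, hns, h⟩
      · exact absurd (h t ((hmem t).2 ht) htz) hzt
      · refine ⟨s, ?_, fun x hx y hy => h x ((hmem x).2 hx) y ((hmem y).2 hy)⟩
        rcases (hmem s).1 hs with h | h
        · exact h
        · exact absurd (hZZ z hz s h hsz.symm) hns
    · push Not at hz
      have hmem : ∀ x, x ∈ S.filter (fun x => x ∈ C) ↔ x ∈ C := by
        intro x
        rw [Finset.mem_filter]
        exact ⟨fun h => h.2, fun h => ⟨(hCD x h).1, h⟩⟩
      have haT : a ∉ S.filter (fun x => x ∈ C) := by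
        rw [hmem]; exact fun h => (hCD a h).2.1 rfl
      obtain ⟨s, hs, h⟩ := simp_exists (G := G) ⟨b, (hmem b).2 hbC⟩
        (ih _ (hsmall _ (Finset.filter_subset _ _) haT))
      refine ⟨s, (hmem s).1 hs, ?_⟩
      intro x hx y hy h1 h2 hxy
      rcases hx with hx | hx
      · rcases hy with hy | hy
        · exact h x ((hmem x).2 hx) y ((hmem y).2 hy) h1 h2 hxy
        · exact (hz y hy x (Or.inl hx) hxy).symm
      · exact hz x hx y hy hxy.symm

theorem dp_of_chordal {G Γ : SimpleGraph V} [Fintype V] (hΓ : ∀ S, ¬ HS Γ S) (hle : G ≤ Γ) {k : ℕ}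
    (hk : ∀ K : Finset V, (∀ x ∈ K, ∀ y ∈ K, x ≠ y → Γ.Adj x y) → K.card ≤ k) :
    DPColorable G k := by
  classical
  rintro H ⟨-, H2, H3⟩
  rcases isEmpty_or_nonempty V with hV | ⟨⟨v0⟩⟩
  · exact ⟨fun v => (hV.false v).elim, fun u => (hV.false u).elim⟩
  have hk1 : 1 ≤ k := by
    have := hk {v0} (by
      intro x hx y hy hxy
      rw [Finset.mem_singleton] at hx hy
      exact absurd (hx.trans hy.symm) hxy)
    simpa using this
  suffices h : ∀ (N : ℕ) (S : Finset V), S.card ≤ N →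
      ∃ f : V → Fin k, ∀ u ∈ S, ∀ v ∈ S, ¬ H.Adj (u, f u) (v, f v) by
    obtain ⟨f, hf⟩ := h _ Finset.univ le_rfl
    exact ⟨f, fun u v => hf u (Finset.mem_univ _) v (Finset.mem_univ _)⟩
  intro N
  induction N with
  | zero =>
    intro S hS
    refine ⟨fun _ => ⟨0, hk1⟩, fun u hu => ?_⟩
    rw [Finset.card_eq_zero.1 (Nat.le_zero.1 hS)] at hu
    simp at hu
  | succ N ih =>
    intro S hS
    rcases S.eq_empty_or_nonempty with rfl | hne
    · exact ⟨fun _ => ⟨0, hk1⟩, fun u hu => by simp at hu⟩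
    obtain ⟨s, hs, hsimp⟩ := simp_exists hne (dirac hΓ _ S le_rfl)
    obtain ⟨f, hf⟩ := ih (S.erase s) (by rw [Finset.card_erase_of_mem hs]; omega)
    let M := S.filter (fun x => Γ.Adj s x)
    have hM : ∀ x, x ∈ M ↔ x ∈ S ∧ Γ.Adj s x := fun x => Finset.mem_filter
    have hMc : M.card + 1 ≤ k := by
      have hsM : s ∉ M := fun h => ((hM s).1 h).2.ne rfl
      rw [← Finset.card_insert_of_notMem hsM]
      apply hk
      intro x hx y hy hxy
      rw [Finset.mem_insert] at hx hy
      rcases hx with rfl | hx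
      · rcases hy with rfl | hy
        · exact absurd rfl hxy
        · exact ((hM y).1 hy).2
      · rcases hy with rfl | hy
        · exact ((hM x).1 hx).2.symm
        · exact hsimp x ((hM x).1 hx).1 y ((hM y).1 hy).1 ((hM x).1 hx).2 ((hM y).1 hy).2 hxy
    let F := M.biUnion (fun u => Finset.univ.filter (fun c : Fin k => H.Adj (u, f u) (s, c)))
    have hF : F.card ≤ M.card * 1 := by
      apply Finset.card_biUnion_le_card_mul
      intro u hu
      rw [Finset.card_le_one]
      intro c hc d hd
      simp only [Finset.mem_filter, Finset.mem_univ, true_and] at hc hd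
      exact H3 u s _ _ _ ((hM u).1 hu).2.ne.symm hc hd
    obtain ⟨c, hc⟩ : ∃ c, c ∉ F := by
      by_contra hcon
      push Not at hcon
      have : F = Finset.univ := Finset.eq_univ_iff_forall.2 hcon
      rw [this, Finset.card_univ, Fintype.card_fin] at hF
      omega
    have hsc : ∀ u ∈ S, u ≠ s → ¬ H.Adj (u, f u) (s, c) := by
      intro u hu hus hA
      apply hc
      rw [Finset.mem_biUnion]
      exact ⟨u, (hM u).2 ⟨hu, (hle (H2 _ _ _ _ hus hA)).symm⟩, by simp [hA]⟩
    refine ⟨Function.update f s c, fun u hu v hv => ?_⟩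
    by_cases hus : u = s
    · subst hus
      by_cases hvs : v = u
      · subst hvs; exact H.irrefl
      · rw [Function.update_self, Function.update_of_ne hvs]
        exact fun h => hsc v hv hvs h.symm
    · by_cases hvs : v = s
      · subst hvs
        rw [Function.update_self, Function.update_of_ne hus]
        exact hsc u hu hus
      · rw [Function.update_of_ne hvs, Function.update_of_ne hus]
        exact hf u (Finset.mem_erase.2 ⟨hus, hu⟩) v (Finset.mem_erase.2 ⟨hvs, hv⟩)

theorem induce_connected {G : SimpleGraph V} {C : Set V} {b : V} (hb : b ∈ C)
    (h : ∀ c ∈ C, Conn G C b c) : (G.induce C).Connected := by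
  rw [SimpleGraph.connected_iff_exists_forall_reachable]
  refine ⟨⟨b, hb⟩, ?_⟩
  rintro ⟨c, hc⟩
  have key : ∀ y, Conn G C b y → ∀ hy : y ∈ C, (G.induce C).Reachable ⟨b, hb⟩ ⟨y, hy⟩ := by
    intro y hy
    induction hy with
    | refl => intro _; exact Reachable.refl _
    | tail h1 h2 ih =>
      intro hy
      refine (ih h2.2.1).trans (Adj.reachable ?_)
      simpa using h2.1
  exact key c (h c hc) hc

theorem minor_of_near {G : SimpleGraph V} {K : Finset V} (hK : Near G K) {n : ℕ}
    (hn : n ≤ K.card) : HasMinor G (⊤ : SimpleGraph (Fin n)) := by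
  classical
  rcases Nat.eq_zero_or_pos n with rfl | hn0
  · exact ⟨fun _ => ∅, fun i => i.elim0, fun i => i.elim0, fun i => i.elim0, fun i => i.elim0⟩
  obtain ⟨v, hv, hN, hH⟩ : ∃ v ∈ K, NearAt G K v := by
    rcases hK with h | h
    · obtain ⟨v, hv⟩ := Finset.card_pos.1 (by omega : 0 < K.card)
      exact ⟨v, hv, fun x hx y hy hxy _ _ => h x hx y hy hxy,
        fun w hw hwv => Or.inl (h v hv w hw hwv.symm)⟩
    · exact h
  have ⟨e⟩ : Nonempty (Fin n ↪ K) := Function.Embedding.nonempty_of_card_le (by simpa using hn)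
  let M : Set V := {x | x ∈ K ∧ x ≠ v}
  let C : Set V := {t | Conn G Mᶜ v t}
  have hvM : v ∈ Mᶜ := fun h => h.2 rfl
  have hCM : ∀ t ∈ C, t ∉ M := fun t ht => Conn.mem ht hvM
  have hvC : v ∈ C := Relation.ReflTransGen.refl
  have hadj : ∀ w ∈ K, w ≠ v → ∃ t ∈ C, G.Adj t w := by
    intro w hw hwv
    by_cases hA : G.Adj v w
    · exact ⟨v, hvC, hA⟩
    rcases hH w hw hwv with h | ⟨S, hS, hvS, hwS⟩
    · exact absurd h hA
    obtain ⟨R1, R2, t1, t2, y1, y2, A1, A2, hanti, -⟩ := split hS hvS hwS hwv.symm hA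
    have good : ∀ R t y, Arc G S v w R t y → t ∉ K → ∃ t ∈ C, G.Adj t w := by
      intro R t y A ht
      refine ⟨t, ?_, A.tt1.symm⟩
      have hRM : R ⊆ Mᶜ := by
        rintro r hr ⟨hrK, hrv⟩
        have hrw : r ≠ w := fun h => A.ht (h ▸ hr)
        have := A.tuniq r hr (hN w hw r hrK hrw.symm hwv hrv)
        exact ht (this ▸ hrK)
      exact (Conn.edge A.uy hvM (hRM A.yR)).trans ((A.conn y A.yR).mono hRM).symm
    by_cases h1 : t1 ∈ K
    swap
    · exact good _ _ _ A1 h1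
    by_cases h2 : t2 ∈ K
    swap
    · exact good _ _ _ A2 h2
    have := hanti t1 A1.t1R t2 A2.t1R
    exact absurd (hN t1 h1 t2 h2 this.1 (fun h => A1.hu (h ▸ A1.t1R)) (fun h => A2.hu (h ▸ A2.t1R)))
      this.2
  have he : ∀ i j, i ≠ j → (e i : V) ≠ e j := fun i j hij h => hij (e.injective (Subtype.ext h))
  refine ⟨fun i => if (e i : V) = v then C else {(e i : V)}, ?_, ?_, ?_, ?_⟩
  · intro i
    dsimp only
    split_ifs
    · exact ⟨v, hvC⟩
    · exact ⟨_, rfl⟩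
  · intro i
    have key : ∀ S : Set V, S = C ∨ S = {(e i : V)} → (G.induce S).Connected := by
      rintro S (h | h)
      · rw [h]; exact induce_connected hvC (conn_comp hvM)
      · rw [h]; exact induce_connected (b := (e i : V)) rfl (by rintro c rfl; exact .refl)
    apply key
    dsimp only
    split_ifs
    · exact Or.inl rfl
    · exact Or.inr rfl
  · intro i j hij
    dsimp only
    split_ifs with h1 h2 h2
    · exact absurd (h1.trans h2.symm) (he i j hij)
    · rw [Set.disjoint_singleton_right]; exact fun h => hCM _ h ⟨(e j).2, h2⟩
    · rw [Set.disjoint_singleton_left]; exact fun h => hCM _ h ⟨(e i).2, h1⟩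
    · rw [Set.disjoint_singleton]; exact he i j hij
  · intro i j hij
    have hij : i ≠ j := hij
    dsimp only
    split_ifs with h1 h2 h2
    · exact absurd (h1.trans h2.symm) (he i j hij)
    · obtain ⟨t, ht, hA⟩ := hadj _ (e j).2 h2
      exact ⟨t, ht, _, rfl, hA⟩
    · obtain ⟨t, ht, hA⟩ := hadj _ (e i).2 h1
      exact ⟨_, rfl, t, ht, hA.symm⟩
    · exact ⟨_, rfl, _, rfl, hN _ (e i).2 _ (e j).2 (he i j hij) h1 h2⟩

theorem le_chordalizeList (l : List V) : ∀ G : SimpleGraph V, G ≤ chordalizeList G l := by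
  induction l with
  | nil => intro G; exact le_rfl
  | cons u l ih => intro G; exact lc_le.trans (ih _)

section chain
variable {G : SimpleGraph V} {k : ℕ} {parts : Fin k → List V}

theorem chain_fst (i : ℕ) (x y : V) : (lcChain G parts (i+1)).1.Adj x y ↔
    (lcChain G parts i).2.Adj x y ∨ (G.Adj x y ∧
      (∀ j : Fin k, i + 1 ≤ (j : ℕ) → x ∉ parts j) ∧ ∀ j : Fin k, i + 1 ≤ (j : ℕ) → y ∉ parts j) := by
  simp [lcChain, removeVerts]

theorem chain_snd (i : ℕ) (h : i < k) : (lcChain G parts (i+1)).2 =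
    chordalizeList (lcChain G parts (i+1)).1 (parts ⟨i, h⟩) := by
  simp [lcChain, h]

theorem chain_zero (x y : V) : (lcChain G parts 0).2.Adj x y ↔
    (G.Adj x y ∧ (∀ j : Fin k, x ∉ parts j) ∧ ∀ j : Fin k, y ∉ parts j) := by
  simp [lcChain, removeVerts]

theorem chain_rem (i : ℕ) (h : i ≤ k) {x y : V} (hxy : G.Adj x y)
    (hx : ∀ j : Fin k, i ≤ (j : ℕ) → x ∉ parts j) (hy : ∀ j : Fin k, i ≤ (j : ℕ) → y ∉ parts j) :
    (lcChain G parts i).2.Adj x y := by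
  cases i with
  | zero => exact (chain_zero x y).2 ⟨hxy, fun j => hx j (Nat.zero_le _), fun j => hy j (Nat.zero_le _)⟩
  | succ i =>
    rw [chain_snd i h]
    exact le_chordalizeList _ _ ((chain_fst i x y).2 (Or.inr ⟨hxy, hx, hy⟩))

theorem HS_nbr {G : SimpleGraph V} {S : Set V} (h : HS G S) {u : V} (hu : u ∈ S) :
    ∃ y, G.Adj u y := by
  obtain ⟨n, f, hf, rfl, -⟩ := HS_rot h hu
  have := hf.1
  exact ⟨f 1, (hf.2.2 0 1 (by omega) (by omega)).2 (Or.inl rfl)⟩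

theorem chain_iso (hS : ∀ i : Fin k, SNC (lcChain G parts ((i:ℕ)+1)).1 {v | v ∈ parts i}) :
    ∀ i, i ≤ k → ∀ x y, (lcChain G parts i).2.Adj x y → ∀ j : Fin k, i ≤ (j : ℕ) → x ∉ parts j := by
  intro i
  induction i with
  | zero => intro _ x y h j _; exact ((chain_zero x y).1 h).2.1 j
  | succ i ih =>
    intro hi x y h j hj
    have h1 : ∀ x y, (lcChain G parts (i+1)).1.Adj x y → x ∉ parts j := by
      intro x y h
      rcases (chain_fst i x y).1 h with h | h
      · exact ih (by omega) x y h j (by omega)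
      · exact h.2.1 j hj
    rw [chain_snd i hi] at h
    rcases chordalizeList_edges _ _ (hS ⟨i, hi⟩) x y h with h | ⟨S, hS, hx, -, -⟩
    · exact h1 x y h
    · obtain ⟨y', hy'⟩ := HS_nbr hS hx
      exact h1 x y' hy'

theorem chain_main (hS : ∀ i : Fin k, SNC (lcChain G parts ((i:ℕ)+1)).1 {v | v ∈ parts i}) :
    ∀ i, i + 1 ≤ k → ∀ K : Set V,
      (∀ x ∈ K, ∀ y ∈ K, x ≠ y → (lcChain G parts (i+1)).2.Adj x y) →
      ∃ R : Finset V, R.card ≤ i ∧ Near G (K \ R) := by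
  classical
  intro i
  induction i with
  | zero =>
    intro hi K hK
    refine ⟨∅, by simp, ?_⟩
    rw [chain_snd 0 hi] at hK
    have hN := near_of_clique (hS ⟨0, hi⟩) hK
    simp only [Finset.coe_empty, Set.diff_empty]
    have hle : ∀ x y, (lcChain G parts 1).1.Adj x y → G.Adj x y := by
      intro x y h
      rcases (chain_fst 0 x y).1 h with h | h
      · exact ((chain_zero x y).1 h).1
      · exact h.1
    have hrem : ∀ x y, (lcChain G parts 1).1.Adj x y → ∀ j : Fin k, 0 + 1 ≤ (j : ℕ) → x ∉ parts j := by
      intro x y h j hj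
      rcases (chain_fst 0 x y).1 h with h | h
      · exact ((chain_zero x y).1 h).2.1 j
      · exact h.2.1 j hj
    have hHS : ∀ S, HS (lcChain G parts 1).1 S → HS G S := by
      intro S hS
      refine HS_congr hS fun x hx y hy => ⟨fun h => ?_, hle x y⟩
      obtain ⟨x', hx'⟩ := HS_nbr hS hx
      obtain ⟨y', hy'⟩ := HS_nbr hS hy
      exact (chain_fst 0 x y).2 (Or.inr ⟨h, hrem x x' hx', hrem y y' hy'⟩)
    rcases hN with h | ⟨v, hv, h1, h2⟩
    · exact Or.inl fun x hx y hy hxy => hle _ _ (h x hx y hy hxy)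
    · refine Or.inr ⟨v, hv, fun x hx y hy a b c => hle _ _ (h1 x hx y hy a b c), fun w hw hwv => ?_⟩
      rcases h2 w hw hwv with h | ⟨S, hS, h⟩
      · exact Or.inl (hle _ _ h)
      · exact Or.inr ⟨S, hHS S hS, h⟩
  | succ i ih =>
    intro hi K hK
    rw [chain_snd (i+1) hi] at hK
    have hN := near_of_clique (hS ⟨i+1, hi⟩) hK
    obtain ⟨R0, hR0, hcl⟩ : ∃ R0 : Finset V, R0.card ≤ 1 ∧ ∀ x ∈ K, x ∉ R0 → ∀ y ∈ K, y ∉ R0 →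
        x ≠ y → (lcChain G parts (i+1+1)).1.Adj x y := by
      rcases hN with h | ⟨v, hv, h1, h2⟩
      · exact ⟨∅, by simp, fun x hx _ y hy _ hxy => h x hx y hy hxy⟩
      · refine ⟨{v}, by simp, fun x hx hxv y hy hyv hxy => ?_⟩
        rw [Finset.mem_singleton] at hxv hyv
        exact h1 x hx y hy hxy hxv hyv
    obtain ⟨R1, hR1, hNear⟩ := ih (by omega) {x | x ∈ K ∧ x ∉ R0 ∧ x ∉ parts ⟨i+1, hi⟩} (by
      rintro x ⟨hx, hx0, hxp⟩ y ⟨hy, hy0, hyp⟩ hxy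
      rcases (chain_fst (i+1) x y).1 (hcl x hx hx0 y hy hy0 hxy) with h | ⟨h, h1, h2⟩
      · exact h
      · refine chain_rem (i+1) (by omega) h ?_ ?_
        · intro j hj
          rcases hj.lt_or_eq with h | h
          · exact h1 j h
          · have : j = ⟨i+1, hi⟩ := Fin.ext h.symm
            rw [this]; exact hxp
        · intro j hj
          rcases hj.lt_or_eq with h | h
          · exact h2 j h
          · have : j = ⟨i+1, hi⟩ := Fin.ext h.symm
            rw [this]; exact hyp)
    refine ⟨R0 ∪ R1, (Finset.card_union_le _ _).trans (by omega), ?_⟩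
    have hp : ∀ x ∈ K \ ((R0 ∪ R1 : Finset V) : Set V), ∀ y ∈ K \ ((R0 ∪ R1 : Finset V) : Set V), x ≠ y →
        (x ∈ parts ⟨i+1, hi⟩ ∨ y ∈ parts ⟨i+1, hi⟩) → G.Adj x y := by
      rintro x ⟨hx, hxR⟩ y ⟨hy, hyR⟩ hxy hp
      simp only [Finset.coe_union, Set.mem_union, Finset.mem_coe, not_or] at hxR hyR
      rcases (chain_fst (i+1) x y).1 (hcl x hx hxR.1 y hy hyR.1 hxy) with h | ⟨h, h1, h2⟩
      · rcases hp with hp | hp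
        · exact absurd hp (chain_iso hS (i+1) (by omega) x y h ⟨i+1, hi⟩ le_rfl)
        · exact absurd hp (chain_iso hS (i+1) (by omega) y x h.symm ⟨i+1, hi⟩ le_rfl)
      · exact h
    have hmem : ∀ x ∈ K \ ((R0 ∪ R1 : Finset V) : Set V), x ∉ parts ⟨i+1, hi⟩ →
        x ∈ {x | x ∈ K ∧ x ∉ R0 ∧ x ∉ parts ⟨i+1, hi⟩} \ (R1 : Set V) := by
      rintro x ⟨hx, hxR⟩ hxp
      simp only [Finset.coe_union, Set.mem_union, Finset.mem_coe, not_or] at hxR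
      exact ⟨⟨hx, hxR.1, hxp⟩, hxR.2⟩
    rcases hNear with h | ⟨v, hv, h1, h2⟩
    · left
      intro x hx y hy hxy
      by_cases hxp : x ∈ parts ⟨i+1, hi⟩
      · exact hp x hx y hy hxy (Or.inl hxp)
      by_cases hyp : y ∈ parts ⟨i+1, hi⟩
      · exact hp x hx y hy hxy (Or.inr hyp)
      exact h x (hmem x hx hxp) y (hmem y hy hyp) hxy
    · right
      have hv' : v ∈ K \ ((R0 ∪ R1 : Finset V) : Set V) := by
        obtain ⟨⟨h1, h2, h3⟩, h4⟩ := hv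
        refine ⟨h1, ?_⟩
        simp only [Finset.coe_union, Set.mem_union, Finset.mem_coe, not_or]
        exact ⟨h2, h4⟩
      refine ⟨v, hv', ?_, ?_⟩
      · intro x hx y hy hxy hxv hyv
        by_cases hxp : x ∈ parts ⟨i+1, hi⟩
        · exact hp x hx y hy hxy (Or.inl hxp)
        by_cases hyp : y ∈ parts ⟨i+1, hi⟩
        · exact hp x hx y hy hxy (Or.inr hyp)
        exact h1 x (hmem x hx hxp) y (hmem y hy hyp) hxy hxv hyv
      · intro w hw hwv
        by_cases hwp : w ∈ parts ⟨i+1, hi⟩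
        · exact Or.inl (hp v hv' w hw hwv.symm (Or.inr hwp))
        · exact h2 w (hmem w hw hwp) hwv

end chain

theorem exists_lc [Fintype V] {G : SimpleGraph V} (hG : ¬ IsChordal G) :
    ∃ k, ∃ (C : Set V) (parts : Fin k → List V), IsHoleCover G C ∧ IsLCPartition G C parts := by
  classical
  let e := Fintype.equivFin V
  let parts : Fin (Fintype.card V) → List V := fun i => [e.symm i]
  have hmem : ∀ i v, v ∈ parts i ↔ v = e.symm i := fun i v => by simp [parts]
  -- every hole of the new graph passes through the new vertex
  have step : ∀ (i : ℕ) (hi : i < Fintype.card V), (∀ S, ¬ HS (lcChain G parts i).2 S) →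
      ∀ S, HS (lcChain G parts (i+1)).1 S → e.symm ⟨i, hi⟩ ∈ S := by
    intro i hi hch S hS
    by_contra hu
    refine hch S (HS_congr hS fun x hx y hy => ?_)
    rw [chain_fst]
    refine ⟨Or.inl, ?_⟩
    rintro (h | ⟨h, h1, h2⟩)
    · exact h
    · have hne : ∀ x ∈ S, (∀ j : Fin (Fintype.card V), i + 1 ≤ (j:ℕ) → x ∉ parts j) →
          ∀ j : Fin (Fintype.card V), i ≤ (j:ℕ) → x ∉ parts j := by
        intro x hx h j hj
        rcases hj.lt_or_eq with h' | h'
        · exact h j h'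
        · have : j = ⟨i, hi⟩ := Fin.ext h'.symm
          rw [this, hmem]
          rintro rfl
          exact hu hx
      exact chain_rem i hi.le h (hne x hx h1) (hne y hy h2)
  have hNCs : ∀ (i : ℕ) (hi : i < Fintype.card V), (∀ S, ¬ HS (lcChain G parts i).2 S) →
      NCs (lcChain G parts (i+1)).1 (e.symm ⟨i, hi⟩) := by
    intro i hi hch S T _ hT _ hu
    exact absurd (step i hi hch T hT) hu
  have hchord : ∀ i, i ≤ Fintype.card V → ∀ S, ¬ HS (lcChain G parts i).2 S := by
    intro i
    induction i with
    | zero =>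
      intro _ S hS
      obtain ⟨n, f, hf, hfS⟩ := id hS
      have h4 := hf.1
      obtain ⟨y, hy⟩ := HS_nbr hS ((hfS (f 0)).2 ⟨0, by omega, rfl⟩)
      exact ((chain_zero _ _).1 hy).2.1 (e (f 0)) ((hmem _ _).2 (by simp))
    | succ i ih =>
      intro hi S hS
      have hch := ih (by omega)
      rw [chain_snd i hi] at hS
      have hS : HS (localChordalize (lcChain G parts (i+1)).1 (e.symm ⟨i, hi⟩)) S := hS
      obtain ⟨h1, h2⟩ := HS_lc (hNCs i hi hch) hS
      exact h2 (step i hi hch S h1)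
  have hne : Nonempty V := by
    by_contra hcon
    exact hG fun a => (hcon ⟨a⟩).elim
  refine ⟨Fintype.card V, Set.univ, parts, ⟨Set.univ_nonempty, fun a w _ =>
    ⟨a, Set.mem_univ _, w.start_mem_support⟩⟩, fun i => by simp [parts], fun i => by simp [parts],
    ?_, ?_, ?_⟩
  · intro i j hij v hv
    rw [hmem] at hv ⊢
    rw [hv]
    exact fun h => hij (e.symm.injective h)
  · ext v
    simp only [Set.mem_ofPred_eq, Set.mem_univ, iff_true]
    exact ⟨e v, by rw [hmem]; simp⟩
  · intro i
    have hch := hchord i i.2.le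
    have hst : ∀ a (w : (lcChain G parts ((i:ℕ)+1)).1.Walk a a), IsHole _ w → e.symm i ∈ w.support :=
      fun a w hw => step i i.2 hch _ (HS_of_hole hw)
    refine ⟨⟨⟨e.symm i, (hmem _ _).2 rfl⟩, fun a w hw => ⟨e.symm i, (hmem _ _).2 rfl, hst a w hw⟩⟩,
      ⟨?_, ?_⟩, chordal_iff.2 (hchord _ i.2)⟩
    · intro u hu a b w w' hw hw' _ h
      rw [(hmem _ _).1 hu] at h
      exact absurd (hst b w' hw') h
    · intro a w hw u hu v hv _ _
      exact ((hmem _ _).1 hu).trans ((hmem _ _).1 hv).symm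

theorem near_card {G : SimpleGraph V} [Fintype V] {K : Finset V} (hK : Near G K) :
    K.card ≤ G.cliqueNum + 1 := by
  classical
  rcases hK with h | ⟨v, hv, h, -⟩
  · have : G.IsClique (K : Set V) := fun x hx y hy hxy => h x hx y hy hxy
    exact (this.card_le_cliqueNum).trans (Nat.le_succ _)
  · have : G.IsClique ((K.erase v : Finset V) : Set V) := by
      intro x hx y hy hxy
      simp only [Finset.coe_erase, Set.mem_diff, Finset.mem_coe, Set.mem_singleton_iff] at hx hy
      exact h x hx.1 y hy.1 hxy hx.2 hy.2
    have h1 := this.card_le_cliqueNum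
    have h2 := Finset.card_erase_of_mem (Finset.mem_coe.1 hv)
    omega

/-- `χ_DP(G) ≤ ω(G) + i(G)` for every finite simple graph `G`, and if
`G` is non-chordal and has no `K_n` minor then `χ_DP(G) ≤ n - 2 + i(G)`. -/
theorem stmt17 {V : Type*} [Fintype V] [DecidableEq V] (G : SimpleGraph V) :
    dpChromaticNumber G ≤ G.cliqueNum + ncIndex G ∧
      (¬ IsChordal G → ∀ n : ℕ, ¬ HasMinor G (⊤ : SimpleGraph (Fin n)) →
        dpChromaticNumber G ≤ n - 2 + ncIndex G) := by
  by_cases hG : IsChordal G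
  · refine ⟨?_, fun h => absurd hG h⟩
    refine (Nat.sInf_le (dp_of_chordal (chordal_iff.1 hG) le_rfl (k := G.cliqueNum) ?_)).trans
      (Nat.le_add_right _ _)
    intro K hK
    have : G.IsClique (K : Set V) := fun x hx y hy hxy => hK x hx y hy hxy
    exact this.card_le_cliqueNum
  · have hidx : ncIndex G = sInf {k | ∃ (C : Set V) (parts : Fin k → List V),
        IsHoleCover G C ∧ IsLCPartition G C parts} := by
      simp [ncIndex, hG]
    have hk := Nat.sInf_mem (s := {k | ∃ (C : Set V) (parts : Fin k → List V),
      IsHoleCover G C ∧ IsLCPartition G C parts}) (exists_lc hG)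
    rw [← hidx] at hk
    generalize ncIndex G = k at *
    obtain ⟨C, parts, hC, -, -, -, hCp, hP⟩ := hk
    have hk1 : 1 ≤ k := by
      obtain ⟨v, hv⟩ := hC.1
      rw [← hCp] at hv
      obtain ⟨i, -⟩ := hv
      exact Nat.succ_le_of_lt (lt_of_le_of_lt (Nat.zero_le _) i.2)
    obtain ⟨m, rfl⟩ : ∃ m, k = m + 1 := ⟨k - 1, by omega⟩
    have hch := chordal_iff.1 (hP ⟨m, by omega⟩).2.2
    have hle : G ≤ (lcChain G parts (m+1)).2 := fun x y h =>
      chain_rem (m+1) le_rfl h (fun j hj => absurd j.2 (by omega)) (fun j hj => absurd j.2 (by omega))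
    have hmain : ∀ K : Finset V, (∀ x ∈ K, ∀ y ∈ K, x ≠ y → (lcChain G parts (m+1)).2.Adj x y) →
        ∃ K' : Finset V, K.card ≤ K'.card + m ∧ Near G K' := by
      intro K hK
      obtain ⟨R, hR, hN⟩ := chain_main (fun i => SNC_of (hP i).2.1) m le_rfl (K : Set V) hK
      refine ⟨K \ R, ?_, by rwa [Finset.coe_sdiff]⟩
      have := Finset.card_le_card_sdiff_add_card (s := K) (t := R)
      omega
    constructor
    · refine Nat.sInf_le (dp_of_chordal hch hle ?_)
      intro K hK
      obtain ⟨K', h1, h2⟩ := hmain K hK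
      have := near_card h2
      omega
    · intro _ n hn
      refine Nat.sInf_le (dp_of_chordal hch hle ?_)
      intro K hK
      obtain ⟨K', h1, h2⟩ := hmain K hK
      have : K'.card < n := by
        by_contra h
        exact hn (minor_of_near h2 (by omega))
      omega
end

section
/- Let G be a non-chordal finite simple graph, let H be a hole of G, and let S be the equivalence class under the relation ∼_G that contains V(H). If adding to G a chord of H (an edge joining two nonadjacent vertices of H) creates a new hole H* (a hole of G + uv that is not a hole of G), then V(H*) ⊆ S. -/
open SimpleGraph

variable {V : Type*}

/-- Two vertices are related if they lie on a common hole of `G`. -/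
def holeRel {V : Type*} (G : SimpleGraph V) (x y : V) : Prop :=
  ∃ (a : V) (w : G.Walk a a), IsHole G w ∧ x ∈ w.support ∧ y ∈ w.support

lemma removeVerts_reach {G : SimpleGraph V} {A : Set V} {a b : V} (p : G.Walk a b) (s t : ℕ)
    (hst : s ≤ t) (ht : t ≤ p.length) (hA : ∀ i, s ≤ i → i ≤ t → p.getVert i ∉ A) :
    (removeVerts G A).Reachable (p.getVert s) (p.getVert t) := by
  induction t, hst using Nat.le_induction with
  | base => exact Reachable.refl _
  | succ n hn ih =>
    refine (ih (by omega) (fun i h1 h2 => hA i h1 (by omega))).trans ?_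
    apply Adj.reachable
    exact ⟨p.adj_getVert_succ (by omega), hA n hn (by omega), hA (n+1) (by omega) le_rfl⟩

/-- shortest walks are induced -/
lemma geodesic_chord {G : SimpleGraph V} {x y : V} (p : G.Walk x y)
    (hp : p.length = G.dist x y) (i j : ℕ) (hij : i < j) (hj : j ≤ p.length)
    (hadj : G.Adj (p.getVert i) (p.getVert j)) : j = i + 1 := by
  have h := dist_le ((p.take i).append (Walk.cons hadj (p.drop j)))
  simp [Walk.length_append, Walk.take_length, Walk.drop_length] at h
  omega

lemma hole_of_reach {G : SimpleGraph V} {d x y : V} (hx : G.Adj d x) (hy : G.Adj d y)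
    (hxy : x ≠ y) (hn : ¬ G.Adj x y)
    (hr : (removeVerts G {z | z = d ∨ (G.Adj d z ∧ z ≠ x ∧ z ≠ y)}).Reachable x y) :
    ∃ (a : V) (w : G.Walk a a), IsHole G w ∧ d ∈ w.support ∧ x ∈ w.support ∧ y ∈ w.support := by
  set A : Set V := {z | z = d ∨ (G.Adj d z ∧ z ≠ x ∧ z ≠ y)} with hA
  obtain ⟨p, hp, hlen⟩ := hr.exists_path_of_dist
  have hle : removeVerts G A ≤ G := fun a b h => h.1
  have hsup : ∀ z ∈ p.support, z ∉ A := by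
    intro z hz
    obtain ⟨i, rfl, hi⟩ := Walk.mem_support_iff_exists_getVert.1 hz
    rcases i with _ | i
    · simp [hA, hx.ne']
    · exact (p.adj_getVert_succ (by omega : i < p.length)).2.2
  have hl2 : 2 ≤ p.length := by
    by_contra hlt
    have h01 : p.length = 0 ∨ p.length = 1 := by omega
    rcases h01 with h0 | h1
    · exact hxy (Walk.eq_of_length_eq_zero h0)
    · exact hn (Walk.adj_of_length_eq_one h1).1
  let q : G.Walk x y := p.mapLe hle
  have hqs : q.support = p.support := by simp [q]
  have hqe : q.edges = p.edges := by simp [q]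
  have hql : q.length = p.length := by simp [q]
  have hqp : q.IsPath := by
    rw [Walk.isPath_def, hqs]; exact (Walk.isPath_def _).1 hp
  have hdq : d ∉ q.support := by
    rw [hqs]; intro h; exact hsup d h (Or.inl rfl)
  refine ⟨d, Walk.cons hx (q.concat hy.symm), ⟨?_, ?_, ?_⟩, ?_, ?_, ?_⟩
  · rw [Walk.cons_isCycle_iff]
    refine ⟨hqp.concat hdq hy.symm, ?_⟩
    rw [Walk.edges_concat]
    simp only [List.concat_eq_append, List.mem_append, List.mem_singleton, not_or]
    refine ⟨fun h => hdq (q.fst_mem_support_of_mem_edges h), ?_⟩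
    intro h
    rw [Sym2.eq_iff] at h
    rcases h with h | h
    · exact hx.ne' h.2
    · exact hxy h.2
  · simp [hql]; omega
  · have key : ∀ z, G.Adj d z → z ∈ q.support → z = x ∨ z = y := by
      intro z hz hzq
      rw [hqs] at hzq
      have := hsup z hzq
      by_contra hcon
      push Not at hcon
      exact this (Or.inr ⟨hz, hcon.1, hcon.2⟩)
    have key2 : ∀ z, G.Adj d z → z ∈ q.support →
        s(d, z) ∈ (Walk.cons hx (q.concat hy.symm)).edges := by
      intro z hz hzq
      rcases key z hz hzq with rfl | rfl
      · simp
      · simp [Walk.edges_concat, Sym2.eq_swap]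
    have key3 : ∀ i j, i < j → j ≤ p.length → G.Adj (p.getVert i) (p.getVert j) →
        s(p.getVert i, p.getVert j) ∈ p.edges := by
      intro i j hij hj hadj
      have := geodesic_chord p hlen i j hij hj
        ⟨hadj, hsup _ (p.getVert_mem_support i), hsup _ (p.getVert_mem_support j)⟩
      subst this
      exact (Walk.mk_mem_edges_iff_exists p).2 ⟨i, by omega, rfl⟩
    intro s t hs ht hst
    have hs' : s = d ∨ s ∈ q.support := by
      simp [Walk.support_concat] at hs; tauto
    have ht' : t = d ∨ t ∈ q.support := by
      simp [Walk.support_concat] at ht; tauto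
    rcases hs' with rfl | hs'
    · rcases ht' with rfl | ht'
      · exact (G.irrefl hst).elim
      · exact key2 t hst ht'
    · rcases ht' with rfl | ht'
      · rw [Sym2.eq_swap]; exact key2 s hst.symm hs'
      · have : s(s, t) ∈ p.edges := by
          rw [hqs] at hs' ht'
          obtain ⟨i, rfl, hi⟩ := Walk.mem_support_iff_exists_getVert.1 hs'
          obtain ⟨j, rfl, hj⟩ := Walk.mem_support_iff_exists_getVert.1 ht'
          rcases lt_trichotomy i j with h | h | h
          · exact key3 i j h hj hst
          · subst h; exact (G.irrefl hst).elim
          · rw [Sym2.eq_swap]; exact key3 j i h hi hst.symm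
        rw [← hqe] at this
        simp [Walk.edges_concat, this]
  · simp
  · simp [Walk.support_concat]
  · simp [Walk.support_concat]

lemma IsHole.rot [DecidableEq V] {G : SimpleGraph V} {a u : V} {w : G.Walk a a}
    (hw : IsHole G w) (hu : u ∈ w.support) :
    IsHole G (w.rotate u hu) := by
  obtain ⟨h1, h2, h3⟩ := hw
  refine ⟨by simpa using h1, by simpa using h2, ?_⟩
  intro x y hx hy hxy
  rw [Walk.mem_support_rotate_iff] at hx hy
  exact (w.rotate_edges u hu).mem_iff.2 (h3 x y hx hy hxy)

lemma IsHole.inj {G : SimpleGraph V} {a : V} {w : G.Walk a a} (hw : IsHole G w) {i j : ℕ}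
    (hi : i < w.length) (hj : j < w.length) (h : w.getVert i = w.getVert j) : i = j :=
  hw.1.getVert_injOn' (by simp only [Set.mem_ofPred_eq]; omega)
    (by simp only [Set.mem_ofPred_eq]; omega) h

lemma IsHole.adj_idx {G : SimpleGraph V} {a : V} {w : G.Walk a a} (hw : IsHole G w) {i j : ℕ}
    (hij : i < j) (hj : j < w.length) (h : G.Adj (w.getVert i) (w.getVert j)) :
    j = i + 1 ∨ (i = 0 ∧ j + 1 = w.length) := by
  have he := hw.2.2 _ _ (w.getVert_mem_support i) (w.getVert_mem_support j) h
  obtain ⟨m, hm, he⟩ := (Walk.mk_mem_edges_iff_exists w).1 he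
  rw [Sym2.eq_iff] at he
  have hl := hw.2.1
  by_cases hm1 : m + 1 = w.length
  · have h0 : w.getVert (m+1) = w.getVert 0 := by rw [hm1]; simp
    rw [h0] at he
    rcases he with ⟨e1, e2⟩ | ⟨e1, e2⟩
    · have := hw.inj hm (by omega) e1
      omega
    · have := hw.inj hm (by omega) e1
      have := hw.inj (by omega) (by omega) e2
      omega
  · rcases he with ⟨e1, e2⟩ | ⟨e1, e2⟩
    · have := hw.inj hm (by omega) e1
      have := hw.inj (by omega) (by omega) e2
      omega
    · have := hw.inj hm (by omega) e1
      have := hw.inj (by omega) (by omega) e2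
      omega

/-- neighbours of both sides: sector through `v` -/
lemma sector1 {G : SimpleGraph V} {u d : V} {h : G.Walk u u} (hh : IsHole G h)
    (hd : d ∉ h.support) (k : ℕ) (hk : ¬ G.Adj d (h.getVert k))
    (i j : ℕ) (hi0 : 0 < i) (hik : i < k) (hkj : k < j) (hj : j < h.length)
    (hi : G.Adj d (h.getVert i)) (hjd : G.Adj d (h.getVert j)) :
    ∃ z ∈ h.support, holeRel G z d := by
  classical
  -- largest `i`
  have e1 : ∃ m, (m < k ∧ G.Adj d (h.getVert (k - m)) ∧ 0 < k - m) :=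
    ⟨k - i, by omega, by rwa [show k - (k - i) = i by omega], by omega⟩
  have e2 : ∃ m, G.Adj d (h.getVert (k + m)) := ⟨j - k, by rwa [show k + (j - k) = j by omega]⟩
  obtain ⟨hm1, hm2, hm3⟩ := Nat.find_spec e1
  have hn := Nat.find_spec e2
  set m := Nat.find e1 with hmdef
  set n := Nat.find e2 with hndef
  have hnle : n ≤ j - k := Nat.find_min' e2 (by rwa [show k + (j - k) = j by omega])
  have hm0 : m ≠ 0 := by rintro h0; rw [h0] at hm2; exact hk hm2
  have hn0 : n ≠ 0 := by rintro h0; rw [h0] at hn; exact hk hn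
  have hne : h.getVert (k - m) ≠ h.getVert (k + n) := by
    intro he
    have := hh.inj (by omega) (by omega) he
    omega
  have hnadj : ¬ G.Adj (h.getVert (k - m)) (h.getVert (k + n)) := by
    intro he
    have := hh.adj_idx (by omega) (by omega) he
    omega
  obtain ⟨a, w, hw, hdw, hxw, -⟩ := hole_of_reach hm2 hn hne hnadj (by
    apply removeVerts_reach h _ _ (by omega) (by omega)
    intro t ht1 ht2 hA
    rcases hA with hA | ⟨hA, hx, hy⟩
    · exact hd (hA ▸ h.getVert_mem_support t)
    · have t1 : t ≠ k - m := by rintro rfl; exact hx rfl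
      have t2 : t ≠ k + n := by rintro rfl; exact hy rfl
      rcases le_or_gt t k with htk | htk
      · refine Nat.find_min e1 (m := k - t) (by omega) ⟨by omega, ?_, by omega⟩
        rwa [show k - (k - t) = t by omega]
      · refine Nat.find_min e2 (m := t - k) (by omega) ?_
        rwa [show k + (t - k) = t by omega])
  exact ⟨_, h.getVert_mem_support _, a, w, hw, hxw, hdw⟩

/-- sector through `u` -/
lemma sector2 {G : SimpleGraph V} {u d : V} {h : G.Walk u u} (hh : IsHole G h)
    (hd : d ∉ h.support) (k : ℕ) (hk : ¬ G.Adj d u)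
    (i j : ℕ) (hi0 : 0 < i) (hik : i < k) (hkj : k < j) (hj : j < h.length)
    (hi : G.Adj d (h.getVert i)) (hjd : G.Adj d (h.getVert j)) :
    ∃ z ∈ h.support, holeRel G z d := by
  classical
  have e1 : ∃ m, G.Adj d (h.getVert m) := ⟨i, hi⟩
  have e2 : ∃ m, G.Adj d (h.getVert (h.length - m)) :=
    ⟨h.length - j, by rwa [show h.length - (h.length - j) = j by omega]⟩
  have hm := Nat.find_spec e1
  have hn := Nat.find_spec e2
  set m := Nat.find e1 with hmdef
  set n := Nat.find e2 with hndef
  have hmle : m ≤ i := Nat.find_min' e1 hi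
  have hnle : n ≤ h.length - j :=
    Nat.find_min' e2 (by rwa [show h.length - (h.length - j) = j by omega])
  have hm0 : m ≠ 0 := by rintro h0; rw [h0] at hm; simp at hm; exact hk hm
  have hn0 : n ≠ 0 := by rintro h0; rw [h0] at hn; simp at hn; exact hk hn
  have hne : h.getVert m ≠ h.getVert (h.length - n) := by
    intro he
    have := hh.inj (by omega) (by omega) he
    omega
  have hnadj : ¬ G.Adj (h.getVert m) (h.getVert (h.length - n)) := by
    intro he
    have := hh.adj_idx (by omega) (by omega) he
    omega
  obtain ⟨a, w, hw, hdw, hxw, -⟩ := hole_of_reach hm hn hne hnadj (by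
    have r1 := removeVerts_reach (A := {z | z = d ∨ (G.Adj d z ∧ z ≠ h.getVert m ∧
        z ≠ h.getVert (h.length - n))}) h 0 m (by omega) (by omega) (by
      intro t ht1 ht2 hA
      rcases hA with hA | ⟨hA, hx, hy⟩
      · exact hd (hA ▸ h.getVert_mem_support t)
      · have t1 : t ≠ m := by rintro rfl; exact hx rfl
        exact Nat.find_min e1 (m := t) (by omega) hA)
    have r2 := removeVerts_reach (A := {z | z = d ∨ (G.Adj d z ∧ z ≠ h.getVert m ∧
        z ≠ h.getVert (h.length - n))}) h (h.length - n) h.length (by omega) (by omega) (by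
      intro t ht1 ht2 hA
      rcases hA with hA | ⟨hA, hx, hy⟩
      · exact hd (hA ▸ h.getVert_mem_support t)
      · have t1 : t ≠ h.length - n := by rintro rfl; exact hy rfl
        refine Nat.find_min e2 (m := h.length - t) (by omega) ?_
        rwa [show h.length - (h.length - t) = t by omega])
    rw [Walk.getVert_zero] at r1
    rw [Walk.getVert_length] at r2
    exact r1.symm.trans r2.symm)
  exact ⟨_, h.getVert_mem_support _, a, w, hw, hxw, hdw⟩

lemma reach_lift {G : SimpleGraph V} {A : Set V} {u v : V}
    (huv : (removeVerts G A).Reachable u v) {x y : V}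
    (hr : (removeVerts (G ⊔ SimpleGraph.fromEdgeSet {s(u, v)}) A).Reachable x y) :
    (removeVerts G A).Reachable x y := by
  obtain ⟨p⟩ := hr
  induction p with
  | nil => exact Reachable.refl _
  | cons hadj p ih =>
    refine Reachable.trans ?_ ih
    obtain ⟨h1, h2, h3⟩ := hadj
    rw [sup_adj, fromEdgeSet_adj] at h1
    rcases h1 with h1 | ⟨h1, -⟩
    · exact Adj.reachable ⟨h1, h2, h3⟩
    · rw [Set.mem_singleton_iff, Sym2.eq_iff] at h1
      rcases h1 with ⟨rfl, rfl⟩ | ⟨rfl, rfl⟩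
      · exact huv
      · exact huv.symm

/-- a vertex of the new hole other than `u`, `v` either shares a hole with a vertex of `h` or
shares a hole with both of its neighbours on the new hole. -/
lemma main_step [DecidableEq V] {G : SimpleGraph V} {u v : V} {h : G.Walk u u}
    (hh : IsHole G h) (hv : v ∈ h.support) (huv : u ≠ v)
    {G' : SimpleGraph V} (hG' : G' = G ⊔ SimpleGraph.fromEdgeSet {s(u, v)})
    {d : V} (hdu : d ≠ u) (hdv : d ≠ v)
    {w : G'.Walk d d}
    (hw : IsHole G' w)
    (huw : u ∈ w.support) (hvw : v ∈ w.support) :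
    (∃ z ∈ h.support, holeRel G z d) ∨
      ∀ x ∈ w.support, G'.Adj d x → holeRel G x d := by
  by_cases hd : d ∈ h.support
  · exact Or.inl ⟨d, hd, u, h, hh, hd, hd⟩
  have hGle : G ≤ G' := hG' ▸ le_sup_left
  have hadjd : ∀ z, G'.Adj d z → G.Adj d z := by
    intro z hz
    rw [hG', sup_adj, fromEdgeSet_adj] at hz
    rcases hz with hz | ⟨hz, -⟩
    · exact hz
    · rw [Set.mem_singleton_iff, Sym2.eq_iff] at hz
      rcases hz with hz | hz
      · exact (hdu hz.1).elim
      · exact (hdv hz.1).elim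
  have hG'uv : G'.Adj u v := by
    rw [hG', sup_adj, fromEdgeSet_adj]; exact Or.inr ⟨rfl, huv⟩
  have hl := hw.2.1
  set x := w.getVert 1 with hxdef
  set y := w.getVert (w.length - 1) with hydef
  have hx' : G'.Adj d x := by simpa using w.adj_getVert_succ (i := 0) (by omega)
  have hy' : G'.Adj d y := by
    have := w.adj_getVert_succ (i := w.length - 1) (by omega)
    rw [show w.length - 1 + 1 = w.length by omega, Walk.getVert_length] at this
    exact this.symm
  have hxy : x ≠ y := by
    intro he
    have := hw.inj (by omega) (by omega) he
    omega
  have hnxy : ¬ G'.Adj x y := by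
    intro he
    have := hw.adj_idx (by omega) (by omega) he
    omega
  have honly : ∀ z ∈ w.support, G'.Adj d z → z = x ∨ z = y := by
    intro z hz hdz
    obtain ⟨i, rfl, hi⟩ := Walk.mem_support_iff_exists_getVert.1 hz
    have hi0 : i ≠ 0 := by rintro rfl; simp at hdz
    have hin : i ≠ w.length := by rintro rfl; simp at hdz
    have hdz' : G'.Adj (w.getVert 0) (w.getVert i) := by simpa using hdz
    rcases hw.adj_idx (by omega) (by omega) hdz' with h1 | h1
    · left; rw [h1]
    · right; rw [hydef]; congr 1; omega
  obtain ⟨k, hk, hkl⟩ := Walk.mem_support_iff_exists_getVert.1 hv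
  have hk0 : k ≠ 0 := by rintro rfl; simp at hk; exact huv hk
  have hkn : k ≠ h.length := by rintro rfl; simp at hk; exact huv hk
  set A : Set V := {z | z = d ∨ (G.Adj d z ∧ z ≠ x ∧ z ≠ y)} with hA
  have huA : u ∉ A := by
    rintro (h1 | ⟨h1, h2, h3⟩)
    · exact hdu h1.symm
    · rcases honly u huw (hGle h1) with h4 | h4 <;> contradiction
  have hvA : v ∉ A := by
    rintro (h1 | ⟨h1, h2, h3⟩)
    · exact hdv h1.symm
    · rcases honly v hvw (hGle h1) with h4 | h4 <;> contradiction
  have hfin : (removeVerts G A).Reachable u v →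
      ∀ z ∈ w.support, G'.Adj d z → holeRel G z d := by
    intro hr z hz hdz
    have hr' : (removeVerts G' A).Reachable x y := by
      apply removeVerts_reach w _ _ (by omega) (by omega)
      rintro i hi1 hi2 (h1 | ⟨h1, h2, h3⟩)
      · have := hw.inj (i := i) (j := 0) (by omega) (by omega) (by simpa using h1)
        omega
      · rcases honly _ (w.getVert_mem_support i) (hGle h1) with h4 | h4 <;> contradiction
    obtain ⟨a, c, hc, hdc, hxc, hyc⟩ := hole_of_reach (hadjd _ hx') (hadjd _ hy') hxy
      (fun hc => hnxy (hGle hc)) (reach_lift hr (hG' ▸ hr'))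
    rcases honly z hz hdz with rfl | rfl
    · exact ⟨a, c, hc, hxc, hdc⟩
    · exact ⟨a, c, hc, hyc, hdc⟩
  by_cases c1 : ∃ i, 0 < i ∧ i < k ∧ G.Adj d (h.getVert i)
  · by_cases c2 : ∃ j, k < j ∧ j < h.length ∧ G.Adj d (h.getVert j)
    · left
      obtain ⟨i, hi0, hik, hi⟩ := c1
      obtain ⟨j, hkj, hjn, hj⟩ := c2
      by_cases hdadjv : G.Adj d v
      · have hdadju : ¬ G.Adj d u := by
          intro hdadju
          rcases honly v hvw (hGle hdadjv) with h1 | h1 <;>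
            rcases honly u huw (hGle hdadju) with h2 | h2
          · exact huv (h2.trans h1.symm)
          · apply hnxy; rw [← h1, ← h2]; exact hG'uv.symm
          · apply hnxy; rw [← h1, ← h2]; exact hG'uv
          · exact huv (h2.trans h1.symm)
        exact sector2 hh hd k hdadju i j hi0 hik hkj hjn hi hj
      · exact sector1 hh hd k (by rwa [hk]) i j hi0 hik hkj hjn hi hj
    · right
      apply hfin
      have := removeVerts_reach (A := A) h k h.length hkl le_rfl (by
        intro t t1 t2
        rcases eq_or_ne t k with rfl | t3
        · rwa [hk]
        rcases eq_or_ne t h.length with rfl | t4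
        · simpa using huA
        rintro (h1 | ⟨h1, -, -⟩)
        · exact hd (h1 ▸ h.getVert_mem_support t)
        · exact c2 ⟨t, by omega, by omega, h1⟩)
      rw [hk, Walk.getVert_length] at this
      exact this.symm
  · right
    apply hfin
    have := removeVerts_reach (A := A) h 0 k (by omega) hkl (by
      intro t t1 t2
      rcases eq_or_ne t k with rfl | t3
      · rwa [hk]
      rcases eq_or_ne t 0 with rfl | t4
      · simpa using huA
      rintro (h1 | ⟨h1, -, -⟩)
      · exact hd (h1 ▸ h.getVert_mem_support t)
      · exact c1 ⟨t, by omega, by omega, h1⟩)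
    rwa [hk, Walk.getVert_zero] at this

/-- if adding a chord `uv` of a hole `h` of a non-chordal graph `G`
creates a new hole `w`, then every vertex of `w` lies in the `∼_G`-equivalence
class containing the vertices of `h` (here realized as the class of `u`, where
`∼_G` is the transitive closure of lying on a common hole). -/
theorem stmt19 {V : Type*} [Fintype V] [DecidableEq V] (G : SimpleGraph V)
    {a : V} (h : G.Walk a a) (hh : IsHole G h)
    (u v : V) (hu : u ∈ h.support) (hv : v ∈ h.support)
    (huv : u ≠ v) (hnadj : ¬ G.Adj u v)
    {b : V} (w : (G ⊔ SimpleGraph.fromEdgeSet {s(u, v)}).Walk b b)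
    (hw : IsHole (G ⊔ SimpleGraph.fromEdgeSet {s(u, v)}) w)
    (hnew : ¬ ∃ hE : (∀ e ∈ w.edges, e ∈ G.edgeSet), IsHole G (w.transfer G hE)) :
    ∀ z ∈ w.support, Relation.TransGen (holeRel G) u z := by
  classical
  have hGle : G ≤ (G ⊔ SimpleGraph.fromEdgeSet {s(u, v)}) := le_sup_left
  have hG'uv : (G ⊔ SimpleGraph.fromEdgeSet {s(u, v)}).Adj u v := by
    rw [sup_adj, fromEdgeSet_adj]; exact Or.inr ⟨rfl, huv⟩
  have huvw : s(u, v) ∈ w.edges := by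
    by_contra hcon
    have hE : ∀ e ∈ w.edges, e ∈ G.edgeSet := by
      intro e he
      have h1 := w.edges_subset_edgeSet he
      induction e using Sym2.ind with
      | _ x y =>
        rw [mem_edgeSet, sup_adj, fromEdgeSet_adj] at h1
        rcases h1 with h1 | ⟨h1, -⟩
        · exact h1
        · rw [Set.mem_singleton_iff] at h1
          rw [h1] at he; exact (hcon he).elim
    refine hnew ⟨hE, hw.1.transfer hE, by simpa using hw.2.1, ?_⟩
    intro x y hx hy hxy
    rw [Walk.support_transfer] at hx hy
    rw [Walk.edges_transfer]
    exact hw.2.2 x y hx hy (hGle hxy)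
  have huw : u ∈ w.support := w.fst_mem_support_of_mem_edges huvw
  have hvw : v ∈ w.support := w.snd_mem_support_of_mem_edges huvw
  have hS : ∀ z ∈ h.support, Relation.TransGen (holeRel G) u z :=
    fun z hz => Relation.TransGen.single ⟨a, h, hh, hu, hz⟩
  have hprop : ∀ c d, c ∈ w.support → d ∈ w.support → (G ⊔ SimpleGraph.fromEdgeSet {s(u, v)}).Adj c d →
      Relation.TransGen (holeRel G) u c → Relation.TransGen (holeRel G) u d := by
    intro c d hc hd hcd hcS
    by_cases hdu : d = u
    · rw [hdu]; exact hS u hu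
    by_cases hdv : d = v
    · rw [hdv]; exact hS v hv
    rcases main_step (hh.rot hu) ((Walk.mem_support_rotate_iff ..).2 hv) huv rfl hdu hdv (hw.rot hd)
      ((Walk.mem_support_rotate_iff ..).2 huw) ((Walk.mem_support_rotate_iff ..).2 hvw) with
      ⟨z, hz, hzd⟩ | h1
    · exact (hS z ((Walk.mem_support_rotate_iff ..).1 hz)).tail hzd
    · exact hcS.tail (h1 c ((Walk.mem_support_rotate_iff ..).2 hc) hcd.symm)
  have hidx : ∀ i, i ≤ w.length →
      Relation.TransGen (holeRel G) u ((w.rotate u huw).getVert i) := by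
    intro i
    induction i with
    | zero => intro _; rw [Walk.getVert_zero]; exact hS u hu
    | succ i ih =>
      intro hi
      refine hprop _ _ ?_ ?_ ((w.rotate u huw).adj_getVert_succ ?_) (ih (by omega))
      · exact (Walk.mem_support_rotate_iff ..).1 (Walk.getVert_mem_support _ _)
      · exact (Walk.mem_support_rotate_iff ..).1 (Walk.getVert_mem_support _ _)
      · rw [Walk.length_rotate]; omega
  intro z hz
  obtain ⟨i, rfl, hi⟩ := Walk.mem_support_iff_exists_getVert.1
    ((Walk.mem_support_rotate_iff w u huw).2 hz)
  exact hidx i (by simpa using hi)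
end
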